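/- arXiv:math/0311272 — 2 statements merged into one kernel-verified Lean document; each statement's English description precedes it below -/
import Mathlib

section
/- The number of vertices of any Lannér diagram does not exceed 5. In matrix form: let M be a real symmetric N×N matrix with M_{ii} = 1 for all i and with each off-diagonal entry M_{ij} (i ≠ j) equal either to −cos(π/m) for some integer m ≥ 2 or to a real number ≤ −1. If every proper principal submatrix of M is positive definite while M itself is not positive semidefinite, then N ≤ 5. -/
set_option linter.unnecessarySeqFocus false
set_option linter.unusedSimpArgs false

namespace Lanner

open Finset

/-- The quadratic form of a matrix. -/
noncomputable def Q {N : ℕ} (M : Matrix (Fin N) (Fin N) ℝ) (w : Fin N → ℝ) : ℝ :=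
  ∑ i, ∑ j, w i * M i j * w j

/-- The properties of the Gram matrix of a Lannér diagram which are used below. -/
structure Lan {N : ℕ} (M : Matrix (Fin N) (Fin N) ℝ) : Prop where
  symm : ∀ i j, M i j = M j i
  diag : ∀ i, M i i = 1
  entries : ∀ i j, i ≠ j → M i j = 0 ∨ M i j = -1/2 ∨ M i j = -(√2)/2 ∨ M i j ≤ -4/5
  pos : ∀ w : Fin N → ℝ, (∃ z, w z = 0) → (∃ y, w y ≠ 0) → 0 < Q M w
  six : 6 ≤ N

/-- Adjacency in the diagram. -/
def Ad {N : ℕ} (M : Matrix (Fin N) (Fin N) ℝ) (x y : Fin N) : Prop := x ≠ y ∧ M x y ≠ 0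

/-- `w` is nonnegative with form at most `q`. -/
def T {N : ℕ} (M : Matrix (Fin N) (Fin N) ℝ) (w : Fin N → ℝ) (q : ℝ) : Prop :=
  (∀ x, 0 ≤ w x) ∧ Q M w ≤ q

/-- Indicator function of a finite set. -/
def ind {N : ℕ} (S : Finset (Fin N)) : Fin N → ℝ := fun x => if x ∈ S then 1 else 0

theorem sqrt2_bounds : 1.41 < √2 ∧ √2 < 1.42 := by
  constructor
  · apply Real.lt_sqrt_of_sq_lt; norm_num
  · rw [Real.sqrt_lt' (by norm_num)]; norm_num

section
variable {N : ℕ} {M : Matrix (Fin N) (Fin N) ℝ}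

theorem Lan.nonpos (h : Lan M) {i j : Fin N} (hij : i ≠ j) : M i j ≤ 0 := by
  have := sqrt2_bounds
  rcases h.entries i j hij with h | h | h | h <;> linarith

theorem Ad.symm (h : Lan M) {x y : Fin N} (a : Ad M x y) : Ad M y x :=
  ⟨a.1.symm, by rw [h.symm]; exact a.2⟩

theorem Ad.le (h : Lan M) {x y : Fin N} (a : Ad M x y) : M x y ≤ -1/2 := by
  have := sqrt2_bounds
  rcases h.entries x y a.1 with h | h | h | h
  · exact absurd h a.2
  all_goals linarith

theorem Lan.heavy_le (h : Lan M) {x y : Fin N} (a : x ≠ y) (hh : M x y < -1/2) :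
    M x y ≤ -(√2)/2 := by
  have := sqrt2_bounds
  rcases h.entries x y a with h | h | h | h <;> linarith

theorem Ad.of_le {x y : Fin N} (hxy : x ≠ y) (hh : M x y ≤ -1/2) : Ad M x y :=
  ⟨hxy, by intro h0; rw [h0] at hh; norm_num at hh⟩

theorem Lan.ne_of_eq (h : Lan M) {x y : Fin N} (hh : M x y ≤ -1/2) : x ≠ y := by
  rintro rfl; rw [h.diag] at hh; norm_num at hh

theorem Q_update (h : Lan M) (w : Fin N → ℝ) (x : Fin N) (hx : w x = 0) (c : ℝ) :
    Q M (Function.update w x c) = Q M w + 2 * c * (∑ j, w j * M j x) + c ^ 2 := by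
  have e : Function.update w x c = fun j => w j + (if j = x then c else 0) := by
    funext j
    by_cases hj : j = x
    · subst hj; simp [hx]
    · simp [hj]
  have hs : ∑ j, M x j * w j = ∑ j, w j * M j x :=
    Finset.sum_congr rfl fun j _ => by rw [h.symm x j]; ring
  unfold Q
  rw [e]
  simp only [add_mul, mul_add, Finset.sum_add_distrib, ite_mul, mul_ite, zero_mul, mul_zero,
    Finset.sum_ite_eq', Finset.mem_univ, if_true]
  simp only [h.diag]
  have h1 : ∑ i, ∑ j, (if i = x then c * M i j * w j else 0) = c * ∑ j, w j * M j x := by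
    rw [Finset.sum_comm]
    simp only [Finset.sum_ite_eq', Finset.mem_univ, if_true]
    rw [← hs, Finset.mul_sum]
    exact Finset.sum_congr rfl fun j _ => by ring
  have h2 : ∑ i, w i * M i x * c = c * ∑ j, w j * M j x := by
    rw [Finset.mul_sum]
    exact Finset.sum_congr rfl fun j _ => by ring
  rw [h1, h2]
  simp
  ring

theorem T.update (h : Lan M) {w : Fin N → ℝ} {q : ℝ} (t : T M w q) {x : Fin N} (hx : w x = 0)
    (F : Finset (Fin N)) {c : ℝ} (hc : 0 ≤ c) (s : ℝ) (hs : ∑ j ∈ F, w j * M j x ≤ - s) :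
    T M (Function.update w x c) (q + c ^ 2 - 2 * c * s) := by
  refine ⟨fun j => ?_, ?_⟩
  · by_cases hj : j = x
    · subst hj; simpa using hc
    · simpa [hj] using t.1 j
  · rw [Q_update h w x hx c]
    have h1 : ∑ j, w j * M j x ≤ ∑ j ∈ F, w j * M j x := by
      have : ∑ j ∈ F, -(w j * M j x) ≤ ∑ j, -(w j * M j x) := by
        apply Finset.sum_le_univ_sum_of_nonneg
        intro j
        by_cases hj : j = x
        · subst hj; simp [hx]
        · have := h.nonpos hj
          have := t.1 j
          nlinarith
      simp only [Finset.sum_neg_distrib] at this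
      linarith
    have := t.2
    nlinarith

theorem T.one (h : Lan M) {w : Fin N → ℝ} {q : ℝ} (t : T M w q) {x y : Fin N} (hx : w x = 0)
    {m : ℝ} (hm : M x y ≤ -m) (c b : ℝ) (hc : 0 ≤ c) (hb : w y = b) (q' : ℝ)
    (hq : q + c ^ 2 - 2 * c * (b * m) ≤ q') :
    T M (Function.update w x c) q' := by
  have := t.update h hx {y} hc (b * m) (by
    rw [Finset.sum_singleton, hb, h.symm]
    have := t.1 y
    rw [hb] at this
    nlinarith)
  exact ⟨this.1, this.2.trans hq⟩

theorem T.absurd (h : Lan M) {w : Fin N → ℝ} {q : ℝ} (t : T M w q) (hq : q ≤ 0) (z y : Fin N)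
    (hz : w z = 0) (hy : w y ≠ 0) : False := by
  have := h.pos w ⟨z, hz⟩ ⟨y, hy⟩
  have := t.2
  linarith

theorem T.single (h : Lan M) (x : Fin N) (c : ℝ) (hc : 0 ≤ c) :
    T M (Function.update 0 x c) (c ^ 2) := by
  have t0 : T M 0 0 := ⟨fun _ => le_rfl, by simp [Q]⟩
  have := t0.update h (x := x) rfl ∅ hc 0 (by simp)
  simpa using this

theorem T.smul {w : Fin N → ℝ} {q : ℝ} (t : T M w q) {c : ℝ} (hc : 0 ≤ c) :
    T M (fun x => c * w x) (c ^ 2 * q) := by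
  refine ⟨fun x => mul_nonneg hc (t.1 x), ?_⟩
  have : Q M (fun x => c * w x) = c ^ 2 * Q M w := by
    unfold Q
    simp only [Finset.mul_sum]
    exact Finset.sum_congr rfl fun i _ => Finset.sum_congr rfl fun j _ => by ring
  rw [this]
  exact mul_le_mul_of_nonneg_left t.2 (sq_nonneg c)

/-- Sets with form at most one (connected sets). -/
def Tr (M : Matrix (Fin N) (Fin N) ℝ) (S : Finset (Fin N)) : Prop := T M (ind S) 1

theorem ind_insert (S : Finset (Fin N)) (x : Fin N) :
    ind (insert x S) = Function.update (ind S) x 1 := by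
  funext j
  by_cases hj : j = x
  · subst hj; simp [ind]
  · simp [ind, hj]

theorem Tr.single (h : Lan M) (x : Fin N) : Tr M {x} := by
  have := T.single h x 1 (by norm_num)
  have e : ind ({x} : Finset (Fin N)) = Function.update (0 : Fin N → ℝ) x 1 := by
    rw [← insert_empty_eq, ind_insert]
    have : ind (∅ : Finset (Fin N)) = 0 := by funext j; simp [ind]
    rw [this]
  unfold Tr; rw [e]; simpa using this

theorem Tr.insert (h : Lan M) {S : Finset (Fin N)} (t : Tr M S) {x y : Fin N} (hx : x ∉ S)
    (hy : y ∈ S) (a : Ad M x y) : Tr M (insert x S) := by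
  unfold Tr
  rw [ind_insert]
  have := a.le h
  exact T.one h t (by simp [ind, hx]) (m := 1/2) (y := y) (by linarith) 1 1 (by norm_num)
    (by simp [ind, hy]) 1 (by norm_num)

theorem cycle (h : Lan M) {S : Finset (Fin N)} (t : Tr M S) {x y y' : Fin N} (hx : x ∉ S)
    (hy : y ∈ S) (hy' : y' ∈ S) (hne : y ≠ y') (a : Ad M x y) (a' : Ad M x y')
    (z : Fin N) (hz : z ∉ S) (hzx : z ≠ x) : False := by
  have h1 := a.le h
  have h2 := a'.le h
  have := T.update h t (x := x) (by simp [ind, hx]) {y, y'} (c := 1) (by norm_num) 1 (by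
    rw [Finset.sum_pair hne]
    simp only [ind, hy, hy', if_true]
    rw [h.symm y, h.symm y']; linarith)
  exact this.absurd h (by norm_num) z x (by simp [ind, hz, hzx]) (by simp)

theorem fork4 (h : Lan M) {S : Finset (Fin N)} (t : Tr M S) {x₁ x₂ x₃ x₄ y₁ y₂ y₃ y₄ : Fin N}
    (hy₁ : y₁ ∈ S) (hy₂ : y₂ ∈ S) (hy₃ : y₃ ∈ S) (hy₄ : y₄ ∈ S)
    (hx₁ : x₁ ∉ S) (hx₂ : x₂ ∉ S) (hx₃ : x₃ ∉ S) (hx₄ : x₄ ∉ S)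
    (a₁ : Ad M x₁ y₁) (a₂ : Ad M x₂ y₂) (a₃ : Ad M x₃ y₃) (a₄ : Ad M x₄ y₄)
    (z : Fin N) (hz : z ∉ S) (hd : [x₁, x₂, x₃, x₄, z].Nodup) : False := by
  simp only [List.nodup_cons, List.mem_cons, List.not_mem_nil, or_false, not_or] at hd
  have h1 := a₁.le h
  have h2 := a₂.le h
  have h3 := a₃.le h
  have h4 := a₄.le h
  have t0 := T.smul t (c := 2) (by norm_num)
  have t1 := T.one h t0 (x := x₁) (y := y₁) (m := 1/2) (by simp [ind, *]) (by linarith) 1 2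
    (by norm_num) (by simp [ind, *]) 3 (by norm_num)
  have t2 := T.one h t1 (x := x₂) (y := y₂) (m := 1/2) (by simp only [Function.update_apply, ind] <;> grind) (by linarith) 1 2
    (by norm_num) (by simp only [Function.update_apply, ind] <;> grind) 2 (by norm_num)
  have t3 := T.one h t2 (x := x₃) (y := y₃) (m := 1/2) (by simp only [Function.update_apply, ind] <;> grind) (by linarith) 1 2
    (by norm_num) (by simp only [Function.update_apply, ind] <;> grind) 1 (by norm_num)
  have t4 := T.one h t3 (x := x₄) (y := y₄) (m := 1/2) (by simp only [Function.update_apply, ind] <;> grind) (by linarith) 1 2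
    (by norm_num) (by simp only [Function.update_apply, ind] <;> grind) 0 (by norm_num)
  exact t4.absurd h le_rfl z x₄ (by simp only [Function.update_apply, ind] <;> grind) (by simp)

theorem fork3 (h : Lan M) {S : Finset (Fin N)} (t : Tr M S) {x₁ x₂ x₃ y₁ y₂ y₃ : Fin N}
    (hy₁ : y₁ ∈ S) (hy₂ : y₂ ∈ S) (hy₃ : y₃ ∈ S)
    (hx₁ : x₁ ∉ S) (hx₂ : x₂ ∉ S) (hx₃ : x₃ ∉ S)
    (a₁ : Ad M x₁ y₁) (a₂ : Ad M x₂ y₂) (a₃ : M x₃ y₃ < -1/2)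
    (z : Fin N) (hz : z ∉ S) (hd : [x₁, x₂, x₃, z].Nodup) : False := by
  simp only [List.nodup_cons, List.mem_cons, List.not_mem_nil, or_false, not_or] at hd
  have h1 := a₁.le h
  have h2 := a₂.le h
  have h3 := h.heavy_le (h.ne_of_eq a₃.le) a₃
  have hs : √2 * √2 = 2 := Real.mul_self_sqrt (by norm_num)
  have t0 := T.smul t (c := 2) (by norm_num)
  have t1 := T.one h t0 (x := x₁) (y := y₁) (m := 1/2) (by simp [ind, *]) (by linarith) 1 2
    (by norm_num) (by simp [ind, *]) 3 (by norm_num)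
  have t2 := T.one h t1 (x := x₂) (y := y₂) (m := 1/2) (by simp only [Function.update_apply, ind] <;> grind) (by linarith) 1 2
    (by norm_num) (by simp only [Function.update_apply, ind] <;> grind) 2 (by norm_num)
  have t3 := T.one h t2 (x := x₃) (y := y₃) (m := √2/2) (by simp only [Function.update_apply, ind] <;> grind) (by linarith) √2 2
    (by positivity) (by simp only [Function.update_apply, ind] <;> grind) 0 (by nlinarith)
  exact t3.absurd h le_rfl z x₃ (by simp only [Function.update_apply, ind] <;> grind) (by simp)

theorem fork2 (h : Lan M) {S : Finset (Fin N)} (t : Tr M S) {x₂ x₃ y₂ y₃ : Fin N}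
    (hy₂ : y₂ ∈ S) (hy₃ : y₃ ∈ S)
    (hx₂ : x₂ ∉ S) (hx₃ : x₃ ∉ S)
    (a₂ : M x₂ y₂ < -1/2) (a₃ : M x₃ y₃ < -1/2)
    (z : Fin N) (hz : z ∉ S) (hd : [x₂, x₃, z].Nodup) : False := by
  simp only [List.nodup_cons, List.mem_cons, List.not_mem_nil, or_false, not_or] at hd
  have h2 := h.heavy_le (h.ne_of_eq a₂.le) a₂
  have h3 := h.heavy_le (h.ne_of_eq a₃.le) a₃
  have hs : √2 * √2 = 2 := Real.mul_self_sqrt (by norm_num)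
  have t0 := T.smul t (c := 2) (by norm_num)
  have t2 := T.one h t0 (x := x₂) (y := y₂) (m := √2/2) (by simp only [Function.update_apply, ind] <;> grind) (by linarith) √2 2
    (by positivity) (by simp only [Function.update_apply, ind] <;> grind) 2 (by nlinarith)
  have t3 := T.one h t2 (x := x₃) (y := y₃) (m := √2/2) (by simp only [Function.update_apply, ind] <;> grind) (by linarith) √2 2
    (by positivity) (by simp only [Function.update_apply, ind] <;> grind) 0 (by nlinarith)
  exact t3.absurd h le_rfl z x₃ (by simp only [Function.update_apply, ind] <;> grind) (by simp)

/-- No proper `F̃₄`: path `z x q p y` with `p q` heavy, missing node `o`. -/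
theorem noF4 (h : Lan M) {z x q p y o : Fin N} (a₁ : Ad M z x) (a₂ : Ad M x q)
    (a₃ : M p q < -1/2) (a₄ : Ad M y p) (hd : [z, x, q, p, y, o].Nodup) : False := by
  simp only [List.nodup_cons, List.mem_cons, List.not_mem_nil, or_false, not_or] at hd
  have h1 := a₁.le h
  have h2 := a₂.le h
  have h3 := h.heavy_le (h.ne_of_eq a₃.le) a₃
  have h4 := a₄.le h
  have hs : √2 * √2 = 2 := Real.mul_self_sqrt (by norm_num)
  have t0 := T.single h q 3 (by norm_num)
  have t1 := T.one h t0 (x := x) (y := q) (m := 1/2) (by simp only [Function.update_apply, Pi.zero_apply] <;> grind) (by linarith) 2 3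
    (by norm_num) (by simp only [Function.update_apply, Pi.zero_apply] <;> grind) 7 (by norm_num)
  have t2 := T.one h t1 (x := z) (y := x) (m := 1/2) (by simp only [Function.update_apply, Pi.zero_apply] <;> grind) (by linarith) 1 2
    (by norm_num) (by simp only [Function.update_apply, Pi.zero_apply] <;> grind) 6 (by norm_num)
  have t3 := T.one h t2 (x := p) (y := q) (m := √2/2) (by simp only [Function.update_apply, Pi.zero_apply] <;> grind) (by linarith)
    (2 * √2) 3 (by positivity) (by simp only [Function.update_apply, Pi.zero_apply] <;> grind) 2 (by nlinarith)
  have t4 := T.one h t3 (x := y) (y := p) (m := 1/2) (by simp only [Function.update_apply, Pi.zero_apply] <;> grind) (by linarith)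
    √2 (2 * √2) (by positivity) (by simp only [Function.update_apply, Pi.zero_apply] <;> grind) 0 (by nlinarith)
  exact t4.absurd h le_rfl o y (by simp only [Function.update_apply, Pi.zero_apply] <;> grind) (by simp)

/-- No proper `H₅`. -/
theorem noH5 (h : Lan M) {p q x y z o : Fin N} (a₁ : M p q ≤ -4/5) (a₂ : Ad M x q)
    (a₃ : Ad M y x) (a₄ : Ad M z y) (hd : [p, q, x, y, z, o].Nodup) : False := by
  simp only [List.nodup_cons, List.mem_cons, List.not_mem_nil, or_false, not_or] at hd
  have h2 := a₂.le h
  have h3 := a₃.le h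
  have h4 := a₄.le h
  have t0 := T.single h q 4 (by norm_num)
  have t1 := T.one h t0 (x := p) (y := q) (m := 4/5) (by simp only [Function.update_apply, Pi.zero_apply] <;> grind) (by linarith)
    (16/5) 4 (by norm_num) (by simp only [Function.update_apply, Pi.zero_apply] <;> grind) (144/25) (by norm_num)
  have t2 := T.one h t1 (x := x) (y := q) (m := 1/2) (by simp only [Function.update_apply, Pi.zero_apply] <;> grind) (by linarith) 3 4
    (by norm_num) (by simp only [Function.update_apply, Pi.zero_apply] <;> grind) (144/25 - 3) (by norm_num)
  have t3 := T.one h t2 (x := y) (y := x) (m := 1/2) (by simp only [Function.update_apply, Pi.zero_apply] <;> grind) (by linarith)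
    2 3 (by positivity) (by simp only [Function.update_apply, Pi.zero_apply] <;> grind) (144/25 - 5) (by norm_num)
  have t4 := T.one h t3 (x := z) (y := y) (m := 1/2) (by simp only [Function.update_apply, Pi.zero_apply] <;> grind) (by linarith)
    1 2 (by positivity) (by simp only [Function.update_apply, Pi.zero_apply] <;> grind) 0 (by norm_num)
  exact t4.absurd h le_rfl o z (by simp only [Function.update_apply, Pi.zero_apply] <;> grind) (by simp)

theorem noE6 (h : Lan M) {i a b c a' b' c' o : Fin N} (ha : M a i = -1/2) (hb : M b i = -1/2)
    (hc : M c i = -1/2) (ha' : M a' a = -1/2) (hb' : M b' b = -1/2) (hc' : M c' c = -1/2)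
    (hd : [i, a, b, c, a', b', c', o].Nodup) : False := by
  simp only [List.nodup_cons, List.mem_cons, List.not_mem_nil, or_false, not_or] at hd
  have t0 := T.single h i 3 (by norm_num)
  have t1 := T.one h t0 (x := a) (y := i) (m := 1/2) (by simp only [Function.update_apply, Pi.zero_apply] <;> grind) (by linarith)
    2 3 (by norm_num) (by simp only [Function.update_apply, Pi.zero_apply] <;> grind) 7 (by norm_num)
  have t2 := T.one h t1 (x := b) (y := i) (m := 1/2) (by simp only [Function.update_apply, Pi.zero_apply] <;> grind) (by linarith)
    2 3 (by norm_num) (by simp only [Function.update_apply, Pi.zero_apply] <;> grind) 5 (by norm_num)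
  have t3 := T.one h t2 (x := c) (y := i) (m := 1/2) (by simp only [Function.update_apply, Pi.zero_apply] <;> grind) (by linarith)
    2 3 (by norm_num) (by simp only [Function.update_apply, Pi.zero_apply] <;> grind) 3 (by norm_num)
  have t4 := T.one h t3 (x := a') (y := a) (m := 1/2) (by simp only [Function.update_apply, Pi.zero_apply] <;> grind) (by linarith)
    1 2 (by norm_num) (by simp only [Function.update_apply, Pi.zero_apply] <;> grind) 2 (by norm_num)
  have t5 := T.one h t4 (x := b') (y := b) (m := 1/2) (by simp only [Function.update_apply, Pi.zero_apply] <;> grind) (by linarith)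
    1 2 (by norm_num) (by simp only [Function.update_apply, Pi.zero_apply] <;> grind) 1 (by norm_num)
  have t6 := T.one h t5 (x := c') (y := c) (m := 1/2) (by simp only [Function.update_apply, Pi.zero_apply] <;> grind) (by linarith)
    1 2 (by norm_num) (by simp only [Function.update_apply, Pi.zero_apply] <;> grind) 0 (by norm_num)
  exact t6.absurd h le_rfl o c' (by simp only [Function.update_apply, Pi.zero_apply] <;> grind) (by simp)

theorem noE7 (h : Lan M) {i a b c a' b' a'' b'' o : Fin N} (ha : M a i = -1/2)
    (hb : M b i = -1/2)
    (hc : M c i = -1/2) (ha' : M a' a = -1/2) (hb' : M b' b = -1/2) (ha'' : M a'' a' = -1/2)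
    (hb'' : M b'' b' = -1/2)
    (hd : [i, a, b, c, a', b', a'', b'', o].Nodup) : False := by
  simp only [List.nodup_cons, List.mem_cons, List.not_mem_nil, or_false, not_or] at hd
  have t0 := T.single h i 4 (by norm_num)
  have t1 := T.one h t0 (x := a) (y := i) (m := 1/2) (by simp only [Function.update_apply, Pi.zero_apply] <;> grind) (by linarith)
    3 4 (by norm_num) (by simp only [Function.update_apply, Pi.zero_apply] <;> grind) 13 (by norm_num)
  have t2 := T.one h t1 (x := b) (y := i) (m := 1/2) (by simp only [Function.update_apply, Pi.zero_apply] <;> grind) (by linarith)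
    3 4 (by norm_num) (by simp only [Function.update_apply, Pi.zero_apply] <;> grind) 10 (by norm_num)
  have t3 := T.one h t2 (x := c) (y := i) (m := 1/2) (by simp only [Function.update_apply, Pi.zero_apply] <;> grind) (by linarith)
    2 4 (by norm_num) (by simp only [Function.update_apply, Pi.zero_apply] <;> grind) 6 (by norm_num)
  have t4 := T.one h t3 (x := a') (y := a) (m := 1/2) (by simp only [Function.update_apply, Pi.zero_apply] <;> grind) (by linarith)
    2 3 (by norm_num) (by simp only [Function.update_apply, Pi.zero_apply] <;> grind) 4 (by norm_num)
  have t5 := T.one h t4 (x := b') (y := b) (m := 1/2) (by simp only [Function.update_apply, Pi.zero_apply] <;> grind) (by linarith)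
    2 3 (by norm_num) (by simp only [Function.update_apply, Pi.zero_apply] <;> grind) 2 (by norm_num)
  have t6 := T.one h t5 (x := a'') (y := a') (m := 1/2) (by simp only [Function.update_apply, Pi.zero_apply] <;> grind) (by linarith)
    1 2 (by norm_num) (by simp only [Function.update_apply, Pi.zero_apply] <;> grind) 1 (by norm_num)
  have t7 := T.one h t6 (x := b'') (y := b') (m := 1/2) (by simp only [Function.update_apply, Pi.zero_apply] <;> grind) (by linarith)
    1 2 (by norm_num) (by simp only [Function.update_apply, Pi.zero_apply] <;> grind) 0 (by norm_num)
  exact t7.absurd h le_rfl o b'' (by simp only [Function.update_apply, Pi.zero_apply] <;> grind) (by simp)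

theorem noE8 (h : Lan M) {i a b c a' b₂ b₃ b₄ b₅ o : Fin N} (ha : M a i = -1/2)
    (hb : M b i = -1/2)
    (hc : M c i = -1/2) (ha' : M a' a = -1/2) (hb₂ : M b₂ b = -1/2) (hb₃ : M b₃ b₂ = -1/2)
    (hb₄ : M b₄ b₃ = -1/2) (hb₅ : M b₅ b₄ = -1/2)
    (hd : [i, a, b, c, a', b₂, b₃, b₄, b₅, o].Nodup) : False := by
  simp only [List.nodup_cons, List.mem_cons, List.not_mem_nil, or_false, not_or] at hd
  have t0 := T.single h i 6 (by norm_num)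
  have t1 := T.one h t0 (x := a) (y := i) (m := 1/2) (by simp only [Function.update_apply, Pi.zero_apply] <;> grind) (by linarith)
    4 6 (by norm_num) (by simp only [Function.update_apply, Pi.zero_apply] <;> grind) 28 (by norm_num)
  have t2 := T.one h t1 (x := b) (y := i) (m := 1/2) (by simp only [Function.update_apply, Pi.zero_apply] <;> grind) (by linarith)
    5 6 (by norm_num) (by simp only [Function.update_apply, Pi.zero_apply] <;> grind) 23 (by norm_num)
  have t3 := T.one h t2 (x := c) (y := i) (m := 1/2) (by simp only [Function.update_apply, Pi.zero_apply] <;> grind) (by linarith)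
    3 6 (by norm_num) (by simp only [Function.update_apply, Pi.zero_apply] <;> grind) 14 (by norm_num)
  have t4 := T.one h t3 (x := a') (y := a) (m := 1/2) (by simp only [Function.update_apply, Pi.zero_apply] <;> grind) (by linarith)
    2 4 (by norm_num) (by simp only [Function.update_apply, Pi.zero_apply] <;> grind) 10 (by norm_num)
  have t5 := T.one h t4 (x := b₂) (y := b) (m := 1/2) (by simp only [Function.update_apply, Pi.zero_apply] <;> grind) (by linarith)
    4 5 (by norm_num) (by simp only [Function.update_apply, Pi.zero_apply] <;> grind) 6 (by norm_num)
  have t6 := T.one h t5 (x := b₃) (y := b₂) (m := 1/2) (by simp only [Function.update_apply, Pi.zero_apply] <;> grind) (by linarith)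
    3 4 (by norm_num) (by simp only [Function.update_apply, Pi.zero_apply] <;> grind) 3 (by norm_num)
  have t7 := T.one h t6 (x := b₄) (y := b₃) (m := 1/2) (by simp only [Function.update_apply, Pi.zero_apply] <;> grind) (by linarith)
    2 3 (by norm_num) (by simp only [Function.update_apply, Pi.zero_apply] <;> grind) 1 (by norm_num)
  have t8 := T.one h t7 (x := b₅) (y := b₄) (m := 1/2) (by simp only [Function.update_apply, Pi.zero_apply] <;> grind) (by linarith)
    1 2 (by norm_num) (by simp only [Function.update_apply, Pi.zero_apply] <;> grind) 0 (by norm_num)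
  exact t8.absurd h le_rfl o b₅ (by simp only [Function.update_apply, Pi.zero_apply] <;> grind) (by simp)

/-- A positive vector with `M v < 0`. -/
structure Neg (M : Matrix (Fin N) (Fin N) ℝ) (v : Fin N → ℝ) : Prop where
  pos : ∀ x, 0 < v x
  neg : ∀ x, ∑ j, M x j * v j < 0

variable {v : Fin N → ℝ}

theorem Neg.ineq (h : Lan M) (hv : Neg M v) (t : Fin N) (F : Finset (Fin N)) (ht : t ∉ F)
    (hF : ∀ y, Ad M t y → y ∈ F) : v t < ∑ j ∈ F, (-M t j) * v j := by
  have h1 := hv.neg t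
  have h2 : ∑ j, M t j * v j = ∑ j ∈ insert t F, M t j * v j := by
    symm
    apply Finset.sum_subset (Finset.subset_univ _)
    intro y _ hy
    simp only [Finset.mem_insert, not_or] at hy
    have : M t y = 0 := by
      by_contra hne
      exact hy.2 (hF y ⟨fun e => hy.1 e.symm, hne⟩)
    rw [this, zero_mul]
  rw [h2, Finset.sum_insert ht, h.diag] at h1
  simp only [neg_mul, Finset.sum_neg_distrib]
  linarith

/-- The diagram is connected. -/
theorem Neg.conn (h : Lan M) (hv : Neg M v) (S : Finset (Fin N)) (x₀ : Fin N) (hx₀ : x₀ ∈ S)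
    (hS : S.card < N) : ∃ x ∈ S, ∃ y, y ∉ S ∧ Ad M y x := by
  by_contra hcon
  push Not at hcon
  obtain ⟨z, hz⟩ : ∃ z, z ∉ S := by
    by_contra hall
    push Not at hall
    have : S = Finset.univ := Finset.eq_univ_iff_forall.2 hall
    rw [this] at hS
    simp at hS
  have := h.pos (fun x => if x ∈ S then v x else 0) ⟨z, by simp [hz]⟩
    ⟨x₀, by simp [hx₀, (hv.pos x₀).ne']⟩
  have hle : Q M (fun x => if x ∈ S then v x else 0) ≤ 0 := by
    unfold Q
    apply Finset.sum_nonpos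
    intro i _
    by_cases hi : i ∈ S
    · have e : ∑ j, (if i ∈ S then v i else 0) * M i j * (if j ∈ S then v j else 0)
          = v i * ∑ j, M i j * v j := by
        rw [Finset.mul_sum]
        apply Finset.sum_congr rfl
        intro j _
        by_cases hj : j ∈ S
        · simp [hi, hj]; ring
        · have : M i j = 0 := by
            by_contra hne
            apply hcon i hi j hj
            refine ⟨fun e => hj (e ▸ hi), ?_⟩
            rw [h.symm]; exact hne
          simp [this]
      rw [e]
      exact (mul_neg_of_pos_of_neg (hv.pos i) (hv.neg i)).le
    · simp [hi]
  linarith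

theorem exists_not_mem (h : Lan M) (S : Finset (Fin N)) (hS : S.card ≤ 5) : ∃ z, z ∉ S := by
  by_contra hall
  push Not at hall
  have : S = Finset.univ := Finset.eq_univ_iff_forall.2 hall
  have h6 := h.six
  rw [this] at hS
  simp at hS
  omega

theorem exists_missing (h : Lan M) (a b c d e : Fin N) :
    ∃ z, z ≠ a ∧ z ≠ b ∧ z ≠ c ∧ z ≠ d ∧ z ≠ e := by
  obtain ⟨z, hz⟩ := exists_not_mem h {a, b, c, d, e} Finset.card_le_five
  exact ⟨z, by simpa using hz⟩

theorem conn4 (h : Lan M) (hv : Neg M v) (a b c d : Fin N) :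
    ∃ y, y ≠ a ∧ y ≠ b ∧ y ≠ c ∧ y ≠ d ∧ (Ad M y a ∨ Ad M y b ∨ Ad M y c ∨ Ad M y d) := by
  have h6 := h.six
  obtain ⟨x, hx, y, hy, hxy⟩ := hv.conn h {a, b, c, d} a (by simp)
    (lt_of_le_of_lt Finset.card_le_four (by omega))
  simp only [Finset.mem_insert, Finset.mem_singleton, not_or] at hx hy
  refine ⟨y, hy.1, hy.2.1, hy.2.2.1, hy.2.2.2, ?_⟩
  rcases hx with rfl | rfl | rfl | rfl <;> simp [hxy]

/-- No `B̃₃`: heavy edge `p q`, two further neighbours of `q`. -/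
theorem noB3 (h : Lan M) {p q x y : Fin N} (hpq : M p q < -1/2) (hx : Ad M x q) (hy : Ad M y q)
    (hd : x ≠ y ∧ x ≠ p ∧ y ≠ p) : False := by
  obtain ⟨z, hz⟩ := exists_missing h p q x y y
  have := hx.1
  have := hy.1
  have := h.ne_of_eq hpq.le
  refine fork3 h (Tr.single h q) (y₁ := q) (y₂ := q) (y₃ := q) (by simp) (by simp) (by simp)
    ?_ ?_ ?_ hx hy hpq z ?_ ?_ <;> simp <;> grind

/-- Once a heavy edge `p q` has a neighbour `x` of `q`, and `p q x y` is a path, it is an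
end of a long path. -/
theorem heavy_path (h : Lan M) (hv : Neg M v) {p q x y : Fin N} (hpq : M p q < -1/2)
    (hx : Ad M x q) (hy : Ad M y x) (hd : [p, q, x, y].Nodup) :
    M p q = -(√2)/2 ∧ (∀ u, Ad M p u → u = q) ∧ (∀ u, Ad M q u → u = p ∨ u = x) ∧
      M q x = -1/2 := by
  simp only [List.nodup_cons, List.mem_cons, List.not_mem_nil, or_false, not_or] at hd
  have apq : Ad M p q := Ad.of_le (by tauto) hpq.le
  have hqp : M q p < -1/2 := by rw [h.symm]; exact hpq
  have tq := Tr.single h q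
  have tqx : Tr M {x, q} := tq.insert h (by simp; grind) (y := q) (by simp) hx
  have tqxy : Tr M {y, x, q} := tqx.insert h (by simp; grind) (y := x) (by simp) hy
  have hleaf : ∀ u, Ad M p u → u = q := by
    intro u hu
    by_contra hne
    have hup := hu.1
    obtain ⟨o, ho⟩ := exists_missing h p q x y u
    by_cases hux : u = x
    · subst hux
      exact cycle h tqx (x := p) (y := q) (y' := u) (by simp; grind) (by simp) (by simp)
        (by grind) apq hu o (by simp; grind) (by grind)
    by_cases huy : u = y
    · subst huy
      exact cycle h tqxy (x := p) (y := q) (y' := u) (by simp; grind) (by simp) (by simp)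
        (by grind) apq hu o (by simp; grind) (by grind)
    · exact noF4 h hy hx hpq (hu.symm h) (o := o) (by simp; grind)
  have hq : ∀ u, Ad M q u → u = p ∨ u = x := by
    intro u hu
    by_contra hne
    push Not at hne
    exact noB3 h hpq hx (hu.symm h) (by grind)
  refine ⟨?_, hleaf, hq, ?_⟩
  · rcases h.entries p q (by tauto) with h1 | h1 | h1 | h1
    · rw [h1] at hpq; norm_num at hpq
    · rw [h1] at hpq; norm_num at hpq
    · exact h1
    · exfalso
      obtain ⟨z, hzp, hzq, hzx, hzy, hz⟩ := conn4 h hv p q x y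
      obtain ⟨o, ho⟩ := exists_missing h p q x y z
      rcases hz with hz | hz | hz | hz
      · exact hzq (hleaf z (hz.symm h))
      · rcases hq z (hz.symm h) with e | e <;> contradiction
      · have tqx := Tr.single h q |>.insert h (x := x) (by simp; grind) (y := q) (by simp) hx
        refine fork3 h tqx (y₁ := x) (y₂ := x) (y₃ := q) (by simp) (by simp) (by simp)
          ?_ ?_ ?_ hy hz hpq o ?_ ?_ <;> simp <;> grind
      · exact noH5 h h1 hx hy hz (o := o) (by simp; grind)
  · have h1 := hx.le h
    rw [h.symm] at h1
    by_contra hne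
    have h2 : M x q < -1/2 := by rw [h.symm]; exact lt_of_le_of_ne h1 hne
    obtain ⟨o, ho⟩ := exists_missing h p q x y y
    refine fork2 h tq (y₂ := q) (y₃ := q) (by simp) (by simp) ?_ ?_ hpq h2 o ?_ ?_ <;>
      simp <;> grind

/-- Structure of a heavy edge: one of its orientations. -/
theorem heavy_struct (h : Lan M) (hv : Neg M v) {p q x : Fin N} (hpq : M p q < -1/2)
    (hx : Ad M x q) (hxp : x ≠ p) :
    ∃ x, M p q = -(√2)/2 ∧ (∀ u, Ad M p u → u = q) ∧ (∀ u, Ad M q u → u = p ∨ u = x) ∧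
      M q x = -1/2 := by
  have hpq' := h.ne_of_eq hpq.le
  have hxq := hx.1
  have hqp : M q p < -1/2 := by rw [h.symm]; exact hpq
  obtain ⟨y, hyp, hyq, hyx, -, hy⟩ := conn4 h hv p q x x
  rw [or_self] at hy
  rcases hy with hy | hy | hy
  · exfalso
    obtain ⟨z, hzp, hzq, hzx, hzy, hz⟩ := conn4 h hv p q x y
    obtain ⟨o, ho⟩ := exists_missing h p q x y z
    rcases hz with hz | hz | hz | hz
    · exact noB3 h hqp hy hz (by grind)
    · exact noB3 h hpq hx hz (by grind)
    · exact noF4 h hz hx hpq hy (o := o) (by simp; grind)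
    · exact noF4 h hz hy hqp hx (o := o) (by simp; grind)
  · exact (noB3 h hpq hx hy (by grind)).elim
  · exact ⟨x, heavy_path h hv hpq hx hy (by simp; grind)⟩

/-- The maximum of `v` is not on a heavy edge. -/
theorem max_light (h : Lan M) (hv : Neg M v) {i : Fin N} (hi : ∀ x, v x ≤ v i) {j : Fin N}
    (hij : i ≠ j) : ¬ M i j < -1/2 := by
  intro hh
  have hs : √2 * √2 = 2 := Real.mul_self_sqrt (by norm_num)
  have hb := sqrt2_bounds
  have key : ∀ p q x, M p q = -(√2)/2 → (∀ u, Ad M p u → u = q) →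
      (∀ u, Ad M q u → u = p ∨ u = x) → M q x = -1/2 → (i = p ∨ i = q) → False := by
    intro p q x hpq hp hq hqx hi'
    have hpqne : p ≠ q := h.ne_of_eq (by linarith)
    have hqxne : q ≠ x := h.ne_of_eq (by linarith)
    have h1 := hv.ineq h p {q} (by simpa using hpqne) (by simpa using hp)
    rw [Finset.sum_singleton, hpq] at h1
    have hvp := hv.pos p
    have hvq := hv.pos q
    rcases hi' with rfl | rfl
    · have := hi q
      nlinarith
    · have h2 := hv.ineq h i {p, x} (by simp; grind) (by simpa using hq)
      have hpx : p ≠ x := by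
        rintro rfl
        rw [h.symm, hqx] at hpq
        linarith
      rw [Finset.sum_pair hpx, hqx, h.symm i p, hpq] at h2
      have := hi x
      nlinarith
  have hji : M j i < -1/2 := by rw [h.symm]; exact hh
  obtain ⟨x, hxi, hxj, -, -, hx⟩ := conn4 h hv i j j i
  have hx' : Ad M x i ∨ Ad M x j := by tauto
  rcases hx' with hx | hx
  · obtain ⟨x', h1, h2, h3, h4⟩ := heavy_struct h hv hji hx hxj
    exact key _ _ _ h1 h2 h3 h4 (Or.inr rfl)
  · obtain ⟨x', h1, h2, h3, h4⟩ := heavy_struct h hv hh hx hxi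
    exact key _ _ _ h1 h2 h3 h4 (Or.inl rfl)

/-- Prolonging an arm: `S₀` is connected and contains `i` and `p`, the tip `t` is attached to `p`,
`u₁`, `u₂` are two further neighbours of `i`, and `z` is attached to `u₁`. -/
theorem arm (h : Lan M) (hv : Neg M v) {S₀ : Finset (Fin N)} {t p i u₁ u₂ z : Fin N}
    (hS : Tr M S₀) (ht : t ∉ S₀) (hp : p ∈ S₀) (htp : M t p = -1/2) (hi : i ∈ S₀)
    (hu₁ : u₁ ∉ S₀) (hu₂ : u₂ ∉ S₀) (hz : z ∉ S₀) (a₁ : Ad M u₁ i) (a₂ : Ad M u₂ i)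
    (az : Ad M z u₁) (hd : [t, u₁, u₂, z].Nodup) :
    2 * v t < v p ∨ ∃ x, x ∉ S₀ ∧ x ≠ t ∧ x ≠ u₁ ∧ x ≠ u₂ ∧ x ≠ z ∧ M x t = -1/2 ∧
      2 * v t < v p + v x := by
  simp only [List.nodup_cons, List.mem_cons, List.not_mem_nil, or_false, not_or] at hd
  have hpt : t ≠ p := by rintro rfl; exact ht hp
  have hit : i ≠ t := by rintro rfl; exact ht hi
  have atp : Ad M t p := Ad.of_le hpt htp.le
  have hS1 : Tr M (insert t S₀) := hS.insert h ht hp atp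
  have hS2 : Tr M (insert u₁ (insert t S₀)) :=
    hS1.insert h (by simp; grind) (y := i) (by simp [hi]) a₁
  have hnew : ∀ y, Ad M t y → y = p ∨ (y ∉ S₀ ∧ y ≠ t ∧ y ≠ u₁ ∧ y ≠ u₂ ∧ y ≠ z) := by
    intro y hy
    by_cases hyp : y = p
    · exact Or.inl hyp
    refine Or.inr ⟨?_, hy.1.symm, ?_, ?_, ?_⟩
    · intro hyS
      exact cycle h hS ht hp hyS (Ne.symm hyp) atp hy u₁ hu₁ (by grind)
    · rintro rfl
      exact cycle h hS1 (x := y) (y := i) (y' := t) (by simp; grind) (by simp [hi]) (by simp)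
        hit a₁ (hy.symm h) u₂ (by simp; grind) (by grind)
    · rintro rfl
      exact cycle h hS1 (x := y) (y := i) (y' := t) (by simp; grind) (by simp [hi]) (by simp)
        hit a₂ (hy.symm h) u₁ (by simp; grind) (by grind)
    · rintro rfl
      exact cycle h hS2 (x := y) (y := u₁) (y' := t) (by simp; grind) (by simp) (by simp)
        (by grind) az (hy.symm h) u₂ (by simp; grind) (by grind)
  by_cases hex : ∃ x, Ad M t x ∧ x ≠ p
  · right
    obtain ⟨x, hx, hxp⟩ := hex
    obtain ⟨n1, n2, n3, n4, n5⟩ := (hnew x hx).resolve_left hxp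
    have hlight : M x t = -1/2 := by
      by_contra hne
      have hlt := lt_of_le_of_ne ((hx.symm h).le h) hne
      refine fork3 h hS1 (y₁ := i) (y₂ := i) (y₃ := t) (by simp [hi]) (by simp [hi]) (by simp)
        ?_ ?_ ?_ a₁ a₂ hlt z ?_ ?_ <;> simp <;> grind
    refine ⟨x, n1, n2, n3, n4, n5, hlight, ?_⟩
    have := hv.ineq h t {p, x} (by simp; grind) (by
      intro y hy
      by_contra hy2
      simp only [Finset.mem_insert, Finset.mem_singleton, not_or] at hy2
      obtain ⟨m1, m2, m3, m4, m5⟩ := (hnew y hy).resolve_left hy2.1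
      refine fork4 h hS1 (y₁ := i) (y₂ := i) (y₃ := t) (y₄ := t) (by simp [hi]) (by simp [hi])
        (by simp) (by simp) ?_ ?_ ?_ ?_ a₁ a₂ (hx.symm h) (hy.symm h) z ?_ ?_ <;>
        simp <;> grind)
    rw [Finset.sum_pair (Ne.symm hxp), htp, h.symm t x, hlight] at this
    linarith
  · left
    push Not at hex
    have := hv.ineq h t {p} (by simpa using hpt) (by simpa using hex)
    rw [Finset.sum_singleton, htp] at this
    linarith

/-- The three arms at the maximum, two of them of length at least two. -/
theorem star (h : Lan M) (hv : Neg M v) {i a b c a' b' : Fin N}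
    (hs : 2 * v i < v a + v b + v c)
    (ha : M a i = -1/2) (hb : M b i = -1/2) (hc : M c i = -1/2)
    (ha' : M a' a = -1/2) (hb' : M b' b = -1/2)
    (hva : 2 * v a < v i + v a') (hvb : 2 * v b < v i + v b')
    (hvc : 2 * v c < v i ∨ ∃ x, x ∉ ({i} : Finset (Fin N)) ∧ x ≠ c ∧ x ≠ a ∧ x ≠ b ∧ x ≠ a' ∧
      M x c = -1/2 ∧ 2 * v c < v i + v x)
    (hd : [i, a, b, c, a', b'].Nodup) : False := by
  simp only [List.nodup_cons, List.mem_cons, List.not_mem_nil, or_false, not_or] at hd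
  have pi := hv.pos i
  have ad : ∀ {x y}, M x y = -1/2 → Ad M x y := fun e => Ad.of_le (h.ne_of_eq e.le) e.le
  have ti := Tr.single h i
  have ta : Tr M {a, i} := ti.insert h (by simp; grind) (y := i) (by simp) (ad ha)
  have tb : Tr M {b, i} := ti.insert h (by simp; grind) (y := i) (by simp) (ad hb)
  have tc : Tr M {c, i} := ti.insert h (by simp; grind) (y := i) (by simp) (ad hc)
  have ta' : Tr M {a', a, i} := ta.insert h (by simp; grind) (y := a) (by simp) (ad ha')
  have tb' : Tr M {b', b, i} := tb.insert h (by simp; grind) (y := b) (by simp) (ad hb')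
  have arm_a := arm h hv (S₀ := {a, i}) (t := a') (p := a) (i := i) (u₁ := b) (u₂ := c) (z := b')
    ta (by simp; grind) (by simp) ha' (by simp) (by simp; grind) (by simp; grind) (by simp; grind)
    (ad hb) (ad hc) (ad hb') (by simp; grind)
  have arm_b := arm h hv (S₀ := {b, i}) (t := b') (p := b) (i := i) (u₁ := a) (u₂ := c) (z := a')
    tb (by simp; grind) (by simp) hb' (by simp) (by simp; grind) (by simp; grind) (by simp; grind)
    (ad ha) (ad hc) (ad ha') (by simp; grind)
  rcases hvc with hvc | ⟨c', c1, c2, c3, c4, c5, hc', hvc⟩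
  · -- the arm of `c` has length one
    have one_long : ∀ {a b a' b' b₃ : Fin N}, M a i = -1/2 → M b i = -1/2 → M a' a = -1/2 →
        M b' b = -1/2 → M b₃ b' = -1/2 → 2 * v i < v a + v b + v c → 2 * v a < v i + v a' →
        2 * v a' < v a → 2 * v b < v i + v b' → 2 * v b' < v b + v b₃ → Tr M {b', b, i} →
        [i, a, b, c, a', b', b₃].Nodup → False := by
      intro a b a' b' b₃ ha hb ha' hb' hb₃ hs hva hva' hvb hvb' tb' hd
      simp only [List.nodup_cons, List.mem_cons, List.not_mem_nil, or_false, not_or] at hd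
      have t3 : Tr M {b₃, b', b, i} := tb'.insert h (by simp; grind) (y := b') (by simp) (ad hb₃)
      rcases arm h hv (S₀ := {b', b, i}) (t := b₃) (p := b') (i := i) (u₁ := a) (u₂ := c)
        (z := a') tb' (by simp; grind) (by simp) hb₃ (by simp) (by simp; grind) (by simp; grind)
        (by simp; grind) (ad ha) (ad hc) (ad ha') (by simp; grind)
        with hl | ⟨b₄, n1, n2, n3, n4, n5, hb₄, hv₃⟩
      · linarith
      simp only [Finset.mem_insert, Finset.mem_singleton, not_or] at n1
      have t4 : Tr M {b₄, b₃, b', b, i} :=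
        t3.insert h (by simp; grind) (y := b₃) (by simp) (ad hb₄)
      rcases arm h hv (S₀ := {b₃, b', b, i}) (t := b₄) (p := b₃) (i := i) (u₁ := a) (u₂ := c)
        (z := a') t3 (by simp; grind) (by simp) hb₄ (by simp) (by simp; grind) (by simp; grind)
        (by simp; grind) (ad ha) (ad hc) (ad ha') (by simp; grind)
        with hl | ⟨b₅, m1, m2, m3, m4, m5, hb₅, hv₄⟩
      · linarith
      simp only [Finset.mem_insert, Finset.mem_singleton, not_or] at m1
      rcases arm h hv (S₀ := {b₄, b₃, b', b, i}) (t := b₅) (p := b₄) (i := i) (u₁ := a) (u₂ := c)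
        (z := a') t4 (by simp; grind) (by simp) hb₅ (by simp) (by simp; grind) (by simp; grind)
        (by simp; grind) (ad ha) (ad hc) (ad ha') (by simp; grind)
        with hl | ⟨o, o1, o2, o3, o4, o5, ho, hv₅⟩
      · linarith
      simp only [Finset.mem_insert, Finset.mem_singleton, not_or] at o1
      exact noE8 h ha hb hc ha' hb' hb₃ hb₄ hb₅ (o := o) (by simp; grind)
    rcases arm_a with la | ⟨a₃, n1, n2, n3, n4, n5, ha₃, hva'⟩
    · rcases arm_b with lb | ⟨b₃, m1, m2, m3, m4, m5, hb₃, hvb'⟩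
      · linarith
      · simp only [Finset.mem_insert, Finset.mem_singleton, not_or] at m1
        exact one_long ha hb ha' hb' hb₃ hs hva la hvb hvb' tb' (by simp; grind)
    · simp only [Finset.mem_insert, Finset.mem_singleton, not_or] at n1
      rcases arm_b with lb | ⟨b₃, m1, m2, m3, m4, m5, hb₃, hvb'⟩
      · exact one_long hb ha hb' ha' ha₃ (by linarith) hvb lb hva hva' ta' (by simp; grind)
      · -- `Ẽ₇`
        simp only [Finset.mem_insert, Finset.mem_singleton, not_or] at m1
        have ta3 : Tr M {a₃, a', a, i} :=
          ta'.insert h (by simp; grind) (y := a') (by simp) (ad ha₃)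
        have tb3 : Tr M {b₃, b', b, i} :=
          tb'.insert h (by simp; grind) (y := b') (by simp) (ad hb₃)
        have tab : Tr M {b, a', a, i} := ta'.insert h (by simp; grind) (y := i) (by simp) (ad hb)
        have tab' : Tr M {b', b, a', a, i} :=
          tab.insert h (by simp; grind) (y := b) (by simp) (ad hb')
        have hne : a₃ ≠ b₃ := by
          rintro rfl
          exact cycle h tab' (x := a₃) (y := a') (y' := b') (by simp; grind) (by simp) (by simp)
            (by grind) (ad ha₃) (ad hb₃) c (by simp; grind) (by grind)
        have tab3 : Tr M {a₃, b', b, a', a, i} :=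
          tab'.insert h (by simp; grind) (y := a') (by simp) (ad ha₃)
        have tba3 : Tr M {b₃, b', b, a', a, i} :=
          tab'.insert h (by simp; grind) (y := b') (by simp) (ad hb₃)
        rcases arm h hv (S₀ := {a', a, i}) (t := a₃) (p := a') (i := i) (u₁ := b) (u₂ := c)
          (z := b') ta' (by simp; grind) (by simp) ha₃ (by simp) (by simp; grind) (by simp; grind)
          (by simp; grind) (ad hb) (ad hc) (ad hb') (by simp; grind)
          with la | ⟨o, o1, o2, o3, o4, o5, ho, -⟩
        · rcases arm h hv (S₀ := {b', b, i}) (t := b₃) (p := b') (i := i) (u₁ := a) (u₂ := c)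
            (z := a') tb' (by simp; grind) (by simp) hb₃ (by simp) (by simp; grind)
            (by simp; grind) (by simp; grind) (ad ha) (ad hc) (ad ha') (by simp; grind)
            with lb | ⟨o, o1, o2, o3, o4, o5, ho, -⟩
          · linarith
          · simp only [Finset.mem_insert, Finset.mem_singleton, not_or] at o1
            have : o ≠ a₃ := by
              rintro rfl
              exact cycle h tba3 (x := o) (y := a') (y' := b₃) (by simp; grind) (by simp)
                (by simp) (by grind) (ad ha₃) (ad ho) c (by simp; grind) (by grind)
            exact noE7 h ha hb hc ha' hb' ha₃ hb₃ (o := o) (by simp; grind)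
        · simp only [Finset.mem_insert, Finset.mem_singleton, not_or] at o1
          have : o ≠ b₃ := by
            rintro rfl
            exact cycle h tab3 (x := o) (y := b') (y' := a₃) (by simp; grind) (by simp)
              (by simp) (by grind) (ad hb₃) (ad ho) c (by simp; grind) (by grind)
          exact noE7 h ha hb hc ha' hb' ha₃ hb₃ (o := o) (by simp; grind)
  · -- `Ẽ₆`
    simp only [Finset.mem_singleton] at c1
    have tbc : Tr M {c, b, i} := tb.insert h (by simp; grind) (y := i) (by simp) (ad hc)
    have hcb : c' ≠ b' := by
      rintro rfl
      exact cycle h tbc (x := c') (y := c) (y' := b) (by simp; grind) (by simp) (by simp)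
        (by grind) (ad hc') (ad hb') a (by simp; grind) (by grind)
    have fin : ∀ o, [i, a, b, c, a', b', c', o].Nodup → False := fun o ho =>
      noE6 h ha hb hc ha' hb' hc' ho
    have tac : Tr M {c, a', a, i} := ta'.insert h (by simp; grind) (y := i) (by simp) (ad hc)
    have tbc' : Tr M {c, b', b, i} := tb'.insert h (by simp; grind) (y := i) (by simp) (ad hc)
    have tc' : Tr M {c', c, i} := tc.insert h (by simp; grind) (y := c) (by simp) (ad hc')
    have tcb : Tr M {b, c', c, i} := tc'.insert h (by simp; grind) (y := i) (by simp) (ad hb)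
    rcases arm_a with la | ⟨o, o1, o2, o3, o4, o5, ho, -⟩
    · rcases arm_b with lb | ⟨o, o1, o2, o3, o4, o5, ho, -⟩
      · rcases arm h hv (S₀ := {c, i}) (t := c') (p := c) (i := i) (u₁ := a) (u₂ := b)
          (z := a') tc (by simp; grind) (by simp) hc' (by simp) (by simp; grind)
          (by simp; grind) (by simp; grind) (ad ha) (ad hb) (ad ha') (by simp; grind)
          with lc | ⟨o, o1, o2, o3, o4, o5, ho, -⟩
        · linarith
        · simp only [Finset.mem_insert, Finset.mem_singleton, not_or] at o1
          have : o ≠ b' := by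
            rintro rfl
            exact cycle h tcb (x := o) (y := b) (y' := c') (by simp; grind) (by simp) (by simp)
              (by grind) (ad hb') (ad ho) a (by simp; grind) (by grind)
          exact fin o (by simp; grind)
      · simp only [Finset.mem_insert, Finset.mem_singleton, not_or] at o1
        have : o ≠ c' := by
          rintro rfl
          exact cycle h tbc' (x := o) (y := c) (y' := b') (by simp; grind) (by simp) (by simp)
            (by grind) (ad hc') (ad ho) a (by simp; grind) (by grind)
        exact fin o (by simp; grind)
    · simp only [Finset.mem_insert, Finset.mem_singleton, not_or] at o1
      have : o ≠ c' := by
        rintro rfl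
        exact cycle h tac (x := o) (y := c) (y' := a') (by simp; grind) (by simp) (by simp)
          (by grind) (ad hc') (ad ho) b (by simp; grind) (by grind)
      exact fin o (by simp; grind)

/-- The three arms at the maximum: two of the neighbours have further neighbours. -/
theorem star' (h : Lan M) (hv : Neg M v) {i a b c a' b' : Fin N} (hi : ∀ x, v x ≤ v i)
    (hs : 2 * v i < v a + v b + v c)
    (ha : M a i = -1/2) (hb : M b i = -1/2) (hc : M c i = -1/2)
    (ha' : Ad M a' a) (hb' : Ad M b' b) (hai : a' ≠ i) (hbi : b' ≠ i)
    (hd : [i, a, b, c].Nodup) : False := by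
  simp only [List.nodup_cons, List.mem_cons, List.not_mem_nil, or_false, not_or] at hd
  have ad : ∀ {x y}, M x y = -1/2 → Ad M x y := fun e => Ad.of_le (h.ne_of_eq e.le) e.le
  have ti := Tr.single h i
  obtain ⟨o, ho⟩ := exists_missing h i a b c c
  -- a further neighbour of a neighbour is new
  have new : ∀ {a b c x : Fin N}, M a i = -1/2 → M b i = -1/2 → a ≠ i → b ≠ i → a ≠ b → c ≠ a →
      c ≠ b → c ≠ i → Ad M x a → x ≠ i → x ≠ b := by
    intro a b c x ha hb h1 h2 h3 h4 h5 h6 hx hxi hxb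
    subst hxb
    have ta : Tr M {a, i} := ti.insert h (by simpa using h1) (y := i) (by simp) (ad ha)
    exact cycle h ta (x := x) (y := a) (y' := i) (by simp; grind) (by simp) (by simp) h1 hx
      (ad hb) c (by simp; grind) (by grind)
  have new2 : ∀ {a b c x : Fin N}, M a i = -1/2 → M b i = -1/2 → a ≠ i → b ≠ i → a ≠ b → c ≠ a →
      c ≠ b → c ≠ i → Ad M x a → Ad M x b → x ≠ i → x ≠ c → False := by
    intro a b c x ha hb h1 h2 h3 h4 h5 h6 hx hx2 hxi hxc
    have ta : Tr M {a, i} := ti.insert h (by simpa using h1) (y := i) (by simp) (ad ha)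
    have tab : Tr M {b, a, i} := ta.insert h (by simp; grind) (y := i) (by simp) (ad hb)
    have := hx.1
    have := hx2.1
    exact cycle h tab (x := x) (y := a) (y' := b) (by simp; grind) (by simp) (by simp) h3 hx
      hx2 c (by simp; grind) (by grind)
  have a'b : a' ≠ b := new (c := c) ha hb (by grind) (by grind) (by grind) (by grind) (by grind)
    (by grind) ha' hai
  have a'c : a' ≠ c := new (c := b) ha hc (by grind) (by grind) (by grind) (by grind) (by grind)
    (by grind) ha' hai
  have b'a : b' ≠ a := new (c := c) hb ha (by grind) (by grind) (by grind) (by grind) (by grind)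
    (by grind) hb' hbi
  have b'c : b' ≠ c := new (c := a) hb hc (by grind) (by grind) (by grind) (by grind) (by grind)
    (by grind) hb' hbi
  have a'a := ha'.1
  have b'b := hb'.1
  have arm_a := arm h hv (S₀ := {i}) (t := a) (p := i) (i := i) (u₁ := b) (u₂ := c) (z := b')
    ti (by simp; grind) (by simp) ha (by simp) (by simp; grind) (by simp; grind) (by simp; grind)
    (ad hb) (ad hc) hb' (by simp; grind)
  have arm_b := arm h hv (S₀ := {i}) (t := b) (p := i) (i := i) (u₁ := a) (u₂ := c) (z := a')
    ti (by simp; grind) (by simp) hb (by simp) (by simp; grind) (by simp; grind) (by simp; grind)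
    (ad ha) (ad hc) ha' (by simp; grind)
  have arm_c : ∀ {a b a' : Fin N}, M a i = -1/2 → M b i = -1/2 → M a' a = -1/2 →
      [i, a, b, c, a'].Nodup → _ := fun {a b a'} ha hb ha' hd =>
    arm h hv (S₀ := {i}) (t := c) (p := i) (i := i) (u₁ := a) (u₂ := b) (z := a')
    ti (by simp; grind) (by simp) hc (by simp) (by simp; grind) (by simp; grind) (by simp; grind)
    (ad ha) (ad hb) (ad ha') (by simp; grind)
  have va := hi a
  have vb := hi b
  have vc := hi c
  have arm_c0 := arm h hv (S₀ := {i}) (t := c) (p := i) (i := i) (u₁ := a) (u₂ := b) (z := a')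
    ti (by simp; grind) (by simp) hc (by simp) (by simp; grind) (by simp; grind) (by simp; grind)
    (ad ha) (ad hb) ha' (by simp; grind)
  rcases arm_a with la | ⟨x, x1, x2, x3, x4, x5, hx, hvx⟩
  · rcases arm_b with lb | ⟨y, y1, y2, y3, y4, y5, hy, hvy⟩
    · linarith
    · rcases arm_c0 with lc | ⟨z, z1, z2, z3, z4, z5, hz, hvz⟩
      · linarith
      simp only [Finset.mem_singleton] at y1 z1
      have hyz : y ≠ z := by
        rintro rfl
        exact new2 (c := a) hb hc (by grind) (by grind) (by grind) (by grind) (by grind)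
          (by grind) (ad hy) (ad hz) (by grind) (by grind)
      exact star h hv (i := i) (a := b) (b := c) (c := a) (by linarith) hb hc ha hy hz hvy hvz
        (Or.inl la) (by simp; grind)
  · simp only [Finset.mem_singleton] at x1
    rcases arm_b with lb | ⟨y, y1, y2, y3, y4, y5, hy, hvy⟩
    · rcases arm_c0 with lc | ⟨z, z1, z2, z3, z4, z5, hz, hvz⟩
      · linarith
      simp only [Finset.mem_singleton] at z1
      have hxz : x ≠ z := by
        rintro rfl
        exact new2 (c := b) ha hc (by grind) (by grind) (by grind) (by grind) (by grind)
          (by grind) (ad hx) (ad hz) (by grind) (by grind)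
      exact star h hv (i := i) (a := a) (b := c) (c := b) (by linarith) ha hc hb hx hz hvx hvz
        (Or.inl lb) (by simp; grind)
    · simp only [Finset.mem_singleton] at y1
      have hxy : x ≠ y := by
        rintro rfl
        exact new2 (c := c) ha hb (by grind) (by grind) (by grind) (by grind) (by grind)
          (by grind) (ad hx) (ad hy) (by grind) (by grind)
      exact star h hv (i := i) (a := a) (b := b) (c := c) hs ha hb hc hx hy hvx hvy
        (arm_c ha hb hx (by simp; grind)) (by simp; grind)

theorem false_of_neg (h : Lan M) (hv : Neg M v) : False := by
  have h6 := h.six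
  haveI : Nonempty (Fin N) := ⟨⟨0, by omega⟩⟩
  obtain ⟨i, hi⟩ := Finite.exists_max v
  classical
  have light : ∀ j, Ad M i j → M j i = -1/2 := by
    intro j hj
    by_contra hne
    apply max_light h hv hi hj.1
    rw [h.symm i j]
    exact lt_of_le_of_ne ((hj.symm h).le h) hne
  have hpos := hv.pos i
  set F : Finset (Fin N) := Finset.univ.filter fun j => Ad M i j with hF
  have hmem : ∀ y, y ∈ F ↔ Ad M i y := by simp [hF]
  have hiF : i ∉ F := by rw [hmem]; exact fun hh => hh.1 rfl
  have h1 := hv.ineq h i F hiF (fun y hy => (hmem y).2 hy)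
  have h2 : ∑ j ∈ F, (-M i j) * v j = (1/2) * ∑ j ∈ F, v j := by
    rw [Finset.mul_sum]
    refine Finset.sum_congr rfl fun j hj => ?_
    rw [h.symm i j, light j ((hmem j).1 hj)]; ring
  rw [h2] at h1
  have hc3 : 3 ≤ F.card := by
    by_contra hlt
    have hle : (F.card : ℝ) ≤ 2 := by exact_mod_cast (by omega : F.card ≤ 2)
    have := Finset.sum_le_card_nsmul F v (v i) (fun x _ => hi x)
    rw [nsmul_eq_mul] at this
    nlinarith
  obtain ⟨G, hGF, hG⟩ := Finset.exists_subset_card_eq hc3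
  obtain ⟨a, b, c, hab, hac, hbc, rfl⟩ := Finset.card_eq_three.1 hG
  have aa : Ad M i a := (hmem a).1 (hGF (by simp))
  have ab : Ad M i b := (hmem b).1 (hGF (by simp))
  have ac : Ad M i c := (hmem c).1 (hGF (by simp))
  have n1 := aa.1
  have n2 := ab.1
  have n3 := ac.1
  have hFe : F = {a, b, c} := by
    refine Finset.Subset.antisymm (fun d hd => ?_) hGF
    by_contra hn
    simp only [Finset.mem_insert, Finset.mem_singleton, not_or] at hn
    have adi := (hmem d).1 hd
    have n4 := adi.1
    obtain ⟨o, ho⟩ := exists_missing h i a b c d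
    refine fork4 h (Tr.single h i) (y₁ := i) (y₂ := i) (y₃ := i) (y₄ := i) (by simp) (by simp)
      (by simp) (by simp) ?_ ?_ ?_ ?_ (aa.symm h) (ab.symm h) (ac.symm h) (adi.symm h) o ?_ ?_ <;>
      simp <;> grind
  have hs : 2 * v i < v a + v b + v c := by
    rw [hFe, Finset.sum_insert (by simp; grind), Finset.sum_pair hbc] at h1
    linarith
  have leaf : ∀ x, Ad M i x → (∃ x', Ad M x' x ∧ x' ≠ i) ∨ 2 * v x < v i := by
    intro x hx
    by_cases hex : ∃ x', Ad M x' x ∧ x' ≠ i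
    · exact Or.inl hex
    · right
      push Not at hex
      have := hv.ineq h x {i} (by simpa using hx.1.symm)
        (fun y hy => by simpa using hex y (hy.symm h))
      rw [Finset.sum_singleton, light x hx] at this
      linarith
  have la := light a aa
  have lb := light b ab
  have lc := light c ac
  have va := hi a
  have vb := hi b
  have vc := hi c
  rcases leaf a aa with ⟨a', ha', hai⟩ | ha
  · rcases leaf b ab with ⟨b', hb', hbi⟩ | hb
    · exact star' h hv hi hs la lb lc ha' hb' hai hbi (by simp; grind)
    · rcases leaf c ac with ⟨c', hc', hci⟩ | hc
      · exact star' h hv hi (by linarith) la lc lb ha' hc' hai hci (by simp; grind)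
      · linarith
  · rcases leaf b ab with ⟨b', hb', hbi⟩ | hb
    · rcases leaf c ac with ⟨c', hc', hci⟩ | hc
      · exact star' h hv hi (by linarith) lb lc la hb' hc' hbi hci (by simp; grind)
      · linarith
    · linarith


theorem Q_perturb (h : Lan M) (u : Fin N → ℝ) (k : Fin N) (t : ℝ) :
    Q M (fun i => u i + (if i = k then t else 0)) =
      Q M u + 2 * t * (∑ j, M k j * u j) + t ^ 2 := by
  have e : ∀ i j, (u i + (if i = k then t else 0)) * M i j * (u j + (if j = k then t else 0)) =
      u i * M i j * u j + (if i = k then t * (M i j * u j) else 0)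
      + (if j = k then t * (M j i * u i) else 0)
      + (if i = k then (if j = k then t ^ 2 * M i j else 0) else 0) := by
    intro i j
    rw [h.symm j i]
    split_ifs <;> ring
  simp only [Q, e, Finset.sum_add_distrib, Finset.sum_ite_irrel, Finset.sum_const_zero,
    Finset.sum_ite_eq', Finset.mem_univ, if_true, ← Finset.mul_sum, h.diag]
  ring

theorem sq_perturb (u : Fin N → ℝ) (k : Fin N) (t : ℝ) :
    ∑ i, (u i + (if i = k then t else 0)) ^ 2 = ∑ i, u i ^ 2 + 2 * t * u k + t ^ 2 := by
  have e : ∀ i, (u i + (if i = k then t else 0)) ^ 2 =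
      u i ^ 2 + (if i = k then 2 * t * u i + t ^ 2 else 0) := by
    intro i
    split_ifs <;> ring
  simp only [e, Finset.sum_add_distrib, Finset.sum_ite_eq', Finset.mem_univ, if_true]
  ring

theorem Q_smul (c : ℝ) (w : Fin N → ℝ) : Q M (fun i => c * w i) = c ^ 2 * Q M w := by
  simp only [Q, Finset.mul_sum]
  refine Finset.sum_congr rfl fun i _ => Finset.sum_congr rfl fun j _ => ?_
  ring

theorem Q_abs (h : Lan M) (w : Fin N → ℝ) : Q M (fun i => |w i|) ≤ Q M w := by
  unfold Q
  refine Finset.sum_le_sum fun i _ => Finset.sum_le_sum fun j _ => ?_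
  by_cases hij : i = j
  · subst hij
    rw [h.diag, mul_one, mul_one, abs_mul_abs_self]
  · have h1 := h.nonpos hij
    have h2 : w i * w j ≤ |w i| * |w j| := by rw [← abs_mul]; exact le_abs_self _
    nlinarith

/-- Perron's theorem: there is a positive vector with `M v < 0`. -/
theorem exists_neg (h : Lan M) (x : Fin N → ℝ) (hx : Q M x < 0) : ∃ v, Neg M v := by
  have norm_pos : ∀ y : Fin N → ℝ, y ≠ 0 → 0 < ∑ i, y i ^ 2 := by
    intro y hy
    obtain ⟨i, hi⟩ := Function.ne_iff.mp hy
    exact Finset.sum_pos' (fun _ _ => sq_nonneg _) ⟨i, Finset.mem_univ _, by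
      have : y i ≠ 0 := hi
      positivity⟩
  have scale : ∀ y : Fin N → ℝ, y ≠ 0 →
      ∑ i, ((√(∑ i, y i ^ 2))⁻¹ * y i) ^ 2 = 1 := by
    intro y hy
    have := norm_pos y hy
    simp only [mul_pow, ← Finset.mul_sum, inv_pow]
    rw [Real.sq_sqrt this.le]
    exact inv_mul_cancel₀ this.ne'
  have hQ0 : Q M (0 : Fin N → ℝ) = 0 := by simp [Q]
  have hx0 : x ≠ 0 := by
    rintro rfl
    linarith
  let K : Set (Fin N → ℝ) := {y | ∑ i, y i ^ 2 = 1}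
  have hKc : IsCompact K := by
    apply Metric.isCompact_of_isClosed_isBounded
    · exact isClosed_eq (by fun_prop) continuous_const
    · rw [isBounded_iff_forall_norm_le]
      refine ⟨1, fun y hy => ?_⟩
      rw [pi_norm_le_iff_of_nonneg zero_le_one]
      intro i
      have hy1 : ∑ i, y i ^ 2 = 1 := hy
      have h2 := Finset.single_le_sum (f := fun i => y i ^ 2) (fun j _ => sq_nonneg (y j))
        (Finset.mem_univ i)
      simp only [hy1] at h2
      rw [Real.norm_eq_abs]
      exact (sq_le_one_iff_abs_le_one _).mp h2
  have hcont : Continuous (Q M) := by unfold Q; fun_prop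
  obtain ⟨w, hwK, hmin⟩ := hKc.exists_isMinOn ⟨_, scale x hx0⟩ hcont.continuousOn
  have hw1 : ∑ i, w i ^ 2 = 1 := hwK
  have low : ∀ y : Fin N → ℝ, Q M w * ∑ i, y i ^ 2 ≤ Q M y := by
    intro y
    by_cases hy : y = 0
    · subst hy
      rw [hQ0]; simp
    · have h1 := hmin (scale y hy)
      have hp := norm_pos y hy
      simp only [Set.mem_ofPred_eq, Q_smul, inv_pow, Real.sq_sqrt hp.le] at h1
      rw [inv_mul_eq_div, le_div_iff₀ hp] at h1
      exact h1
  have hneg : Q M w < 0 := by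
    have h1 := low x
    have h2 := norm_pos x hx0
    by_contra hc
    push Not at hc
    nlinarith [mul_nonneg hc h2.le]
  let u : Fin N → ℝ := fun i => |w i|
  have hu1 : ∑ i, u i ^ 2 = 1 := by simpa [u, sq_abs] using hw1
  have huQ : Q M u = Q M w := by
    have h1 := low u
    rw [hu1, mul_one] at h1
    exact le_antisymm (Q_abs h w) h1
  have hune : ∃ y, u y ≠ 0 := by
    by_contra hc
    push Not at hc
    simp [hc] at hu1
  have hupos : ∀ i, 0 < u i := by
    intro i
    refine lt_of_le_of_ne (abs_nonneg _) fun h0 => ?_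
    have := h.pos u ⟨i, h0.symm⟩ hune
    linarith
  refine ⟨u, hupos, fun k => ?_⟩
  have key : ∑ j, M k j * u j = Q M w * u k := by
    have h1 : ∀ t : ℝ, 0 ≤ 2 * t * (∑ j, M k j * u j - Q M w * u k) + t ^ 2 * (1 - Q M w) := by
      intro t
      have h2 := low (fun i => u i + (if i = k then t else 0))
      rw [Q_perturb h, sq_perturb, hu1, huQ] at h2
      linarith
    set d := ∑ j, M k j * u j - Q M w * u k with hd
    have hl : 0 < 1 - Q M w := by linarith
    have h2 := h1 (-d / (1 - Q M w))
    have h3 : 2 * (-d / (1 - Q M w)) * d + (-d / (1 - Q M w)) ^ 2 * (1 - Q M w) =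
        -(d ^ 2 / (1 - Q M w)) := by
      field_simp
      ring
    rw [h3] at h2
    have h4 : d = 0 := by
      by_contra hne
      have : 0 < d ^ 2 / (1 - Q M w) := by positivity
      linarith
    linarith
  rw [key]
  exact mul_neg_of_neg_of_pos hneg (hupos k)

theorem Q_eq_dot (w : Fin N → ℝ) : Star.star w ⬝ᵥ (M.mulVec w) = Q M w := by
  simp only [Q, dotProduct, Matrix.mulVec, Finset.mul_sum, Pi.star_apply, star_trivial, mul_assoc]

/-- The values `-cos(π/m)`. -/
theorem entry_cases {a : ℝ}
    (ha : (∃ m : ℕ, 2 ≤ m ∧ a = -Real.cos (Real.pi / m)) ∨ a ≤ -1) :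
    a = 0 ∨ a = -1/2 ∨ a = -(√2)/2 ∨ a ≤ -4/5 := by
  rcases ha with ⟨m, hm, rfl⟩ | ha
  · rcases Nat.lt_or_ge m 5 with h5 | h5
    · interval_cases m
      · left; simp
      · right; left
        have := Real.cos_pi_div_three
        push_cast
        rw [this]; norm_num
      · right; right; left
        have := Real.cos_pi_div_four
        push_cast
        rw [this]; ring
    · right; right; right
      have h1 : Real.cos (Real.pi / 5) ≤ Real.cos (Real.pi / m) := by
        have hm5 : (5 : ℝ) ≤ m := by exact_mod_cast h5
        apply Real.cos_le_cos_of_nonneg_of_le_pi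
        · positivity
        · have := Real.pi_pos
          linarith
        · exact div_le_div_of_nonneg_left Real.pi_pos.le (by norm_num) hm5
      rw [Real.cos_pi_div_five] at h1
      have h2 : (2.2 : ℝ) ≤ √5 := Real.le_sqrt_of_sq_le (by norm_num)
      linarith
  · right; right; right
    linarith
end

end Lanner

/-- A Lannér diagram has at most 5 vertices: if `M` is a symmetric
real `N × N` matrix with unit diagonal whose off-diagonal entries are each either
`−cos(π/m)` for an integer `m ≥ 2` or a real `≤ −1`, and every proper principal
submatrix of `M` is positive definite while `M` is not positive semidefinite,
then `N ≤ 5`. -/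
theorem lanner_diagram_card_le_five
    (N : ℕ) (M : Matrix (Fin N) (Fin N) ℝ)
    (hsymm : M.IsSymm)
    (hdiag : ∀ i, M i i = 1)
    (hoff : ∀ i j, i ≠ j →
      (∃ m : ℕ, 2 ≤ m ∧ M i j = -Real.cos (Real.pi / m)) ∨ M i j ≤ -1)
    (hproper : ∀ S : Finset (Fin N), S ≠ Finset.univ →
      (M.submatrix (Subtype.val : {i // i ∈ S} → Fin N) Subtype.val).PosDef)
    (hM : ¬ M.PosSemidef) :
    N ≤ 5 := by
  by_contra hN
  have hL : Lanner.Lan M := by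
    refine ⟨fun i j => hsymm.apply j i, hdiag,
      fun i j hij => Lanner.entry_cases (hoff i j hij), ?_, by omega⟩
    rintro w ⟨z, hz⟩ ⟨y, hy⟩
    have hyz : y ≠ z := by
      rintro rfl
      exact hy hz
    have hP := hproper (Finset.univ.erase z) (by
      intro h0
      have := Finset.mem_univ z
      rw [← h0] at this
      simp at this)
    have hne : (fun i : {i // i ∈ Finset.univ.erase z} => w i.1) ≠ 0 := by
      intro h0
      exact hy (congrFun h0 ⟨y, by simp [hyz]⟩)
    have hpos := hP.dotProduct_mulVec_pos hne
    have hsum : ∀ f : Fin N → ℝ, f z = 0 →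
        ∑ i : {i // i ∈ Finset.univ.erase z}, f i.1 = ∑ i, f i := by
      intro f hf
      rw [Finset.sum_coe_sort (Finset.univ.erase z) f]
      exact Finset.sum_erase _ hf
    rw [← Lanner.Q_eq_dot]
    refine lt_of_lt_of_eq hpos ?_
    simp only [dotProduct, Matrix.mulVec, Pi.star_apply, star_trivial, Matrix.submatrix_apply]
    rw [hsum (fun i => w i * ∑ j : {j // j ∈ Finset.univ.erase z}, M i j.1 * w j.1)
      (by simp only [hz, zero_mul])]
    refine Finset.sum_congr rfl fun i _ => ?_
    rw [hsum (fun j => M i j * w j) (by simp only [hz, mul_zero])]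
  have hx : ∃ x, Lanner.Q M x < 0 := by
    by_contra hc
    push Not at hc
    refine hM (Matrix.PosSemidef.of_dotProduct_mulVec_nonneg ?_ fun x => ?_)
    · rw [Matrix.IsHermitian, Matrix.conjTranspose_eq_transpose_of_trivial]
      exact hsymm
    · rw [Lanner.Q_eq_dot]
      exact hc x
  obtain ⟨x, hx⟩ := hx
  obtain ⟨v, hv⟩ := Lanner.exists_neg hL x hx
  exact Lanner.false_of_neg hL hv
end

section
/- The number of vertices of any quasi-Lannér diagram does not exceed 10. In matrix form: let M be a real symmetric N×N matrix with M_{ii} = 1 for all i and with each off-diagonal entry M_{ij} (i ≠ j) equal either to −cos(π/m) for some integer m ≥ 2 or to a real number ≤ −1. If every proper principal submatrix of M is positive semidefinite while M itself is not positive semidefinite, then N ≤ 10. -/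
namespace QLan
open Finset

def Q {N : ℕ} (M : Matrix (Fin N) (Fin N) ℝ) (x : Fin N → ℝ) : ℝ :=
  ∑ i, ∑ j, M i j * (x i * x j)

structure QL {N : ℕ} (M : Matrix (Fin N) (Fin N) ℝ) (s : ℝ) : Prop where
  s0 : 0 < s
  ss : s * s = 1 / 2
  s8 : s ≤ 4 / 5
  sh : 1 / 2 ≤ s
  symm : ∀ i j, M i j = M j i
  diag : ∀ i, M i i = 1
  off : ∀ i j, i ≠ j → M i j = 0 ∨ M i j = -(1/2) ∨ M i j = -s ∨ M i j ≤ -(4/5)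
  sub : ∀ x : Fin N → ℝ, (∃ v, x v = 0) → 0 ≤ Q M x
  npsd : ¬ ∀ x, 0 ≤ Q M x
  hN : 11 ≤ N

theorem psd_of_vec {N : ℕ} {M : Matrix (Fin N) (Fin N) ℝ} (symm : ∀ i j, M i j = M j i)
    (neg : ∀ i j, i ≠ j → M i j ≤ 0) (u : Fin N → ℝ) (hu : ∀ i, 0 < u i)
    (h : ∀ i, 0 ≤ ∑ j, M i j * u j) (x : Fin N → ℝ) : 0 ≤ Q M x := by
  obtain ⟨y, rfl⟩ : ∃ y : Fin N → ℝ, x = fun i => u i * y i :=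
    ⟨fun i => x i / u i, by funext i; have := hu i; field_simp⟩
  have h1 : ∑ i, ∑ j, M i j * (u i * u j * ((y i ^ 2 + y j ^ 2) / 2)) ≤
      Q M (fun i => u i * y i) := by
    unfold Q
    refine sum_le_sum fun i _ => sum_le_sum fun j _ => ?_
    by_cases hij : i = j
    · subst hij; apply le_of_eq; ring
    · have h2 : 0 ≤ -M i j * (u i * u j) :=
        mul_nonneg (by linarith [neg i j hij]) (mul_pos (hu i) (hu j)).le
      nlinarith [mul_nonneg h2 (sq_nonneg (y i - y j))]
  have h3 : ∑ i, ∑ j, M i j * (u i * u j * ((y i ^ 2 + y j ^ 2) / 2)) =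
      ∑ i, (u i * y i ^ 2) * ∑ j, M i j * u j := by
    have e1 : ∑ i, ∑ j, M i j * (u i * u j * ((y i ^ 2 + y j ^ 2) / 2)) =
        ∑ i, ∑ j, M i j * (u i * u j * (y i ^ 2 / 2)) +
        ∑ i, ∑ j, M i j * (u i * u j * (y j ^ 2 / 2)) := by
      rw [← sum_add_distrib]
      refine sum_congr rfl fun i _ => ?_
      rw [← sum_add_distrib]
      refine sum_congr rfl fun j _ => ?_
      ring
    have e2 : ∑ i, ∑ j, M i j * (u i * u j * (y j ^ 2 / 2)) =
        ∑ i, ∑ j, M i j * (u i * u j * (y i ^ 2 / 2)) := by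
      rw [sum_comm]
      refine sum_congr rfl fun i _ => sum_congr rfl fun j _ => ?_
      rw [symm j i]; ring
    rw [e1, e2, ← sum_add_distrib]
    refine sum_congr rfl fun i _ => ?_
    rw [← sum_add_distrib, mul_sum]
    refine sum_congr rfl fun j _ => ?_
    ring
  rw [h3] at h1
  refine le_trans (sum_nonneg fun i _ => mul_nonneg ?_ (h i)) h1
  have := hu i
  positivity

section
variable {N : ℕ} {M : Matrix (Fin N) (Fin N) ℝ} {s : ℝ}

theorem QL.neg (q : QL M s) (i j : Fin N) (h : i ≠ j) : M i j ≤ 0 := by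
  have := q.s0
  rcases q.off i j h with h | h | h | h <;> linarith

theorem QL.half (q : QL M s) {i j : Fin N} (h : M i j < 0) : M i j ≤ -(1/2) := by
  have := q.sh
  have hij : i ≠ j := by rintro rfl; rw [q.diag] at h; linarith
  rcases q.off i j hij with h | h | h | h <;> linarith

theorem QL.heavy (q : QL M s) {i j : Fin N} (h : M i j < -(1/2)) : M i j ≤ -s := by
  have := q.s8
  have := q.s0
  have hij : i ≠ j := by rintro rfl; rw [q.diag] at h; linarith
  rcases q.off i j hij with h | h | h | h <;> linarith

theorem QL.conn (q : QL M s) (S : Finset (Fin N)) (h1 : S.Nonempty) (h2 : S ≠ univ) :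
    ∃ v, v ∉ S ∧ ∃ t ∈ S, M v t ≤ -(1/2) := by
  by_contra hc
  push Not at hc
  have hz : ∀ v, v ∉ S → ∀ t ∈ S, M v t = 0 := by
    intro v hv t ht
    have hvt : v ≠ t := by rintro rfl; exact hv ht
    by_contra h0
    have := q.half (lt_of_le_of_ne (q.neg v t hvt) h0)
    linarith [hc v hv t ht]
  apply q.npsd
  intro x
  have e : Q M x = Q M (fun i => if i ∈ S then x i else 0) +
      Q M (fun i => if i ∈ S then 0 else x i) := by
    unfold Q
    rw [← sum_add_distrib]
    refine sum_congr rfl fun i _ => ?_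
    rw [← sum_add_distrib]
    refine sum_congr rfl fun j _ => ?_
    by_cases hi : i ∈ S <;> by_cases hj : j ∈ S
    · simp [hi, hj]
    · simp [hi, hj, q.symm i j, hz j hj i hi]
    · simp [hi, hj, hz i hi j hj]
    · simp [hi, hj]
  rw [e]
  obtain ⟨t, ht⟩ := h1
  obtain ⟨v, hv⟩ : ∃ v, v ∉ S := by
    by_contra hh; push Not at hh; exact h2 (eq_univ_iff_forall.2 hh)
  exact add_nonneg (q.sub _ ⟨v, by simp [hv]⟩) (q.sub _ ⟨t, by simp [ht]⟩)

theorem QL.pos (q : QL M s) (x : Fin N → ℝ) (T : Finset (Fin N)) (hT : T.Nonempty)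
    (hc : T.card + 2 ≤ N) (hx : ∀ i ∈ T, 0 < x i) (hx' : ∀ i, i ∉ T → x i = 0) :
    0 < Q M x := by
  have hTu : T ≠ univ := by
    rintro rfl; simp at hc
  obtain ⟨v, hv, t, ht, hvt⟩ := q.conn T hT hTu
  have hx0 : ∀ i, 0 ≤ x i := fun i => by
    by_cases h : i ∈ T
    · exact (hx i h).le
    · exact (hx' i h).ge
  have hr : ∑ j, M v j * x j < 0 := by
    apply sum_neg' 
    · intro j _
      by_cases h : j = v
      · subst h; simp [hx' j hv]
      · exact mul_nonpos_of_nonpos_of_nonneg (q.neg v j (Ne.symm h)) (hx0 j)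
    · exact ⟨t, mem_univ _, mul_neg_of_neg_of_pos (by linarith) (hx t ht)⟩
  set r := ∑ j, M v j * x j with hrdef
  have hsub := q.sub (fun i => x i + if i = v then -r else 0) (by
    have : insert v T ≠ univ := by
      intro h
      have h1 := congrArg Finset.card h
      have h2 := card_insert_le v T
      simp at h1
      omega
    obtain ⟨w, hw⟩ : ∃ w, w ∉ insert v T := by
      by_contra hh; push Not at hh; exact this (eq_univ_iff_forall.2 hh)
    simp only [mem_insert, not_or] at hw
    exact ⟨w, by simp [hw.1, hx' w hw.2]⟩)
  have e : Q M (fun i => x i + if i = v then -r else 0) = Q M x + 2 * (-r) * r + r ^ 2 := by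
    have e1 : ∀ i j, M i j * ((x i + if i = v then -r else 0) * (x j + if j = v then -r else 0)) =
      M i j * (x i * x j) + (if i = v then -r * (M i j * x j) else 0) +
        (if j = v then -r * (M j i * x i) else 0) +
        (if i = v then if j = v then r ^ 2 * M i j else 0 else 0) := by
      intro i j
      rw [q.symm j i]
      split_ifs <;> ring
    unfold Q
    simp only [e1, sum_add_distrib]
    have e2 : ∑ i, ∑ j, (if i = v then -r * (M i j * x j) else 0) = -r * r := by
      rw [sum_comm]; simp [← mul_sum, hrdef]
    have e3 : ∑ i, ∑ j, (if j = v then -r * (M j i * x i) else 0) = -r * r := by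
      simp [← mul_sum, hrdef]
    have e4 : ∑ i, ∑ j, (if i = v then if j = v then r ^ 2 * M i j else 0 else 0) = r ^ 2 := by
      rw [sum_comm]; simp [q.diag]
    rw [e2, e3, e4]; ring
  rw [e] at hsub
  nlinarith

theorem QL.posf (q : QL M s) {k : ℕ} (f : Fin k → Fin N) (hf : Function.Injective f)
    (c : Fin k → ℝ) (hc : ∀ a, 0 < c a) (hk : 0 < k) (hk9 : k ≤ 9) :
    0 < ∑ a, ∑ b, M (f a) (f b) * (c a * c b) := by
  have hN := q.hN
  have h := q.pos (Function.extend f c 0) (univ.map ⟨f, hf⟩)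
    (by simp; exact ⟨⟨0, hk⟩, mem_univ _⟩) (by simp; omega)
    (by
      intro i hi
      simp at hi
      obtain ⟨a, rfl⟩ := hi
      rw [hf.extend_apply]; exact hc a)
    (by
      intro i hi
      simp at hi
      rw [Function.extend_apply' _ _ _ (by rintro ⟨a, ha⟩; exact hi a ha)]; rfl)
  have h0 : ∀ i, i ∉ Set.range f → Function.extend f c 0 i = 0 := by
    intro i hi
    rw [Function.extend_apply' _ _ _ hi]; rfl
  unfold Q at h
  rw [← Fintype.sum_of_injective f hf (fun a => ∑ b, M (f a) (f b) * (c a * c b))] at h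
  · exact h
  · intro i hi
    simp [h0 i hi]
  · intro a
    apply Fintype.sum_of_injective f hf
    · intro i hi
      simp [h0 i hi]
    · intro b
      simp [hf.extend_apply]

theorem QL.tree (q : QL M s) {k : ℕ} (f : Fin k → Fin N) (hf : Function.Injective f)
    (p : Fin k → Fin k) (h c : Fin k → ℝ) (hp : ∀ a, p a ≤ a)
    (hM : ∀ a, p a ≠ a → M (f a) (f (p a)) ≤ -h a)
    (hc : ∀ a, 0 < c a) (hk : 0 < k) (hk9 : k ≤ 9) :
    0 < ∑ a, (c a ^ 2 - 2 * (if p a = a then 0 else h a * (c a * c (p a)))) := by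
  refine lt_of_lt_of_le (q.posf f hf c hc hk hk9) ?_
  have e : ∀ a b, M (f a) (f b) * (c a * c b) ≤ (if b = a then c a ^ 2 else 0) -
      (if b = p a then (if p a = a then 0 else h a * (c a * c (p a))) else 0) -
      (if a = p b then (if p b = b then 0 else h b * (c b * c (p b))) else 0) := by
    intro a b
    have hcc := mul_pos (hc a) (hc b)
    by_cases hab : b = a
    · subst hab
      by_cases hb : p b = b
      · simp [hb, q.diag]; exact le_of_eq (by ring)
      · simp [Ne.symm hb, q.diag]; exact le_of_eq (by ring)
    · have hn := q.neg (f a) (f b) (fun h => hab (hf h).symm)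
      by_cases h1 : b = p a
      · have h2 : a ≠ p b := by
          intro h2
          have := hp a; have := hp b
          rw [← h1] at *; rw [← h2] at *
          exact hab (le_antisymm ‹_› ‹_›)
        subst h1
        have := hM a hab
        simp only [hab, h2, if_true, if_false]
        nlinarith
      · by_cases h2 : a = p b
        · subst h2
          have := hM b (Ne.symm hab)
          rw [q.symm] at this
          simp only [hab, h1, Ne.symm hab, if_true, if_false]
          nlinarith
        · simp only [hab, h1, h2, if_false]
          nlinarith
  refine le_trans (sum_le_sum fun a _ => sum_le_sum fun b _ => e a b) (le_of_eq ?_)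
  simp only [sum_sub_distrib]
  have e1 : ∑ a, ∑ b, (if a = p b then (if p b = b then 0 else h b * (c b * c (p b))) else 0) =
    ∑ b, (if p b = b then 0 else h b * (c b * c (p b))) := by
    rw [sum_comm]; simp
  rw [e1, ← mul_sum]
  simp
  ring


theorem QL.grow (q : QL M s) (l : List (Fin N)) (h0 : l ≠ []) (hl : l.length ≤ 9) :
    ∃ v, v ∉ l ∧ ∃ t ∈ l, M v t ≤ -(1/2) := by
  have hN := q.hN
  obtain ⟨v, hv, t, ht, h⟩ := q.conn l.toFinset (by simpa using h0) (by
    intro h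
    have h1 := congrArg Finset.card h
    have h2 := List.toFinset_card_le l
    simp only [card_univ, Fintype.card_fin] at h1
    omega)
  exact ⟨v, by simpa using hv, t, by simpa using ht, h⟩

/-- Affine `A₂`. -/
theorem QL.tri (q : QL M s) {a b c : Fin N} (hn : [a, b, c].Nodup)
    (h1 : M a b ≤ -(1/2)) (h2 : M b c ≤ -(1/2)) (h3 : M a c ≤ -(1/2)) : False := by
  have h := q.posf ![a, b, c] (List.nodup_ofFn.1 (by simpa using hn)) ![1, 1, 1]
    (by simp [Fin.forall_fin_succ]) (by norm_num) (by norm_num)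
  simp [Fin.sum_univ_succ, q.diag, q.symm b a, q.symm c a, q.symm c b] at h
  linarith

/-- Affine `A₃`. -/
theorem QL.sqr (q : QL M s) {a b c d : Fin N} (hn : [a, b, c, d].Nodup)
    (h1 : M a b ≤ -(1/2)) (h2 : M b c ≤ -(1/2)) (h3 : M c d ≤ -(1/2))
    (h4 : M d a ≤ -(1/2)) : False := by
  have h := q.posf ![a, b, c, d] (List.nodup_ofFn.1 (by simpa using hn)) ![1, 1, 1, 1]
    (by simp [Fin.forall_fin_succ]) (by norm_num) (by norm_num)
  have h5 := q.neg a c (by simp at hn; tauto)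
  have h6 := q.neg b d (by simp at hn; tauto)
  simp [Fin.sum_univ_succ, q.diag, q.symm b a, q.symm c a, q.symm c b, q.symm d a,
    q.symm d b, q.symm d c] at h
  rw [q.symm] at h4
  linarith

/-- Affine `D₄`. -/
theorem QL.D4 (q : QL M s) {c a b d e : Fin N} (hn : [c, a, b, d, e].Nodup)
    (h1 : M a c ≤ -(1/2)) (h2 : M b c ≤ -(1/2)) (h3 : M d c ≤ -(1/2))
    (h4 : M e c ≤ -(1/2)) : False := by
  have h := q.tree ![c, a, b, d, e] (List.nodup_ofFn.1 (by simpa using hn))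
    ![0, 0, 0, 0, 0] ![0, 1/2, 1/2, 1/2, 1/2] ![2, 1, 1, 1, 1] (by decide)
    (by simp [Fin.forall_fin_succ] at *; tauto)
    (by simp [Fin.forall_fin_succ]) (by norm_num) (by norm_num)
  simp [Fin.sum_univ_succ] at h
  norm_num at h

/-- Affine `D₅`. -/
theorem QL.D5 (q : QL M s) {a b c d e f : Fin N} (hn : [a, b, c, d, e, f].Nodup)
    (h1 : M b a ≤ -(1/2)) (h2 : M c a ≤ -(1/2)) (h3 : M d a ≤ -(1/2))
    (h4 : M e d ≤ -(1/2)) (h5 : M f d ≤ -(1/2)) : False := by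
  have h := q.tree ![a, b, c, d, e, f] (List.nodup_ofFn.1 (by simpa using hn))
    ![0, 0, 0, 0, 3, 3] ![0, 1/2, 1/2, 1/2, 1/2, 1/2] ![2, 1, 1, 2, 1, 1] (by decide)
    (by simp [Fin.forall_fin_succ] at *; tauto)
    (by simp [Fin.forall_fin_succ]) (by norm_num) (by norm_num)
  simp [Fin.sum_univ_succ] at h
  norm_num at h

/-- Affine `D₆`. -/
theorem QL.D6 (q : QL M s) {a b c g d e f : Fin N} (hn : [a, b, c, g, d, e, f].Nodup)
    (h1 : M b a ≤ -(1/2)) (h2 : M c a ≤ -(1/2)) (h3 : M g a ≤ -(1/2))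
    (h6 : M d g ≤ -(1/2))
    (h4 : M e d ≤ -(1/2)) (h5 : M f d ≤ -(1/2)) : False := by
  have h := q.tree ![a, b, c, g, d, e, f] (List.nodup_ofFn.1 (by simpa using hn))
    ![0, 0, 0, 0, 3, 4, 4] ![0, 1/2, 1/2, 1/2, 1/2, 1/2, 1/2] ![2, 1, 1, 2, 2, 1, 1] (by decide)
    (by simp [Fin.forall_fin_succ] at *; tauto)
    (by simp [Fin.forall_fin_succ]) (by norm_num) (by norm_num)
  simp [Fin.sum_univ_succ] at h
  norm_num at h

/-- Affine `D₇`. -/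
theorem QL.D7 (q : QL M s) {a b c g k d e f : Fin N} (hn : [a, b, c, g, k, d, e, f].Nodup)
    (h1 : M b a ≤ -(1/2)) (h2 : M c a ≤ -(1/2)) (h3 : M g a ≤ -(1/2))
    (h6 : M k g ≤ -(1/2)) (h7 : M d k ≤ -(1/2))
    (h4 : M e d ≤ -(1/2)) (h5 : M f d ≤ -(1/2)) : False := by
  have h := q.tree ![a, b, c, g, k, d, e, f] (List.nodup_ofFn.1 (by simpa using hn))
    ![0, 0, 0, 0, 3, 4, 5, 5] ![0, 1/2, 1/2, 1/2, 1/2, 1/2, 1/2, 1/2]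
    ![2, 1, 1, 2, 2, 2, 1, 1] (by decide)
    (by simp [Fin.forall_fin_succ] at *; tauto)
    (by simp [Fin.forall_fin_succ]) (by norm_num) (by norm_num)
  simp [Fin.sum_univ_succ] at h
  norm_num at h

/-- Affine `E₆`. -/
theorem QL.E6 (q : QL M s) {c a a' b b' d d' : Fin N} (hn : [c, a, a', b, b', d, d'].Nodup)
    (h1 : M a c ≤ -(1/2)) (h2 : M a' a ≤ -(1/2)) (h3 : M b c ≤ -(1/2))
    (h4 : M b' b ≤ -(1/2)) (h5 : M d c ≤ -(1/2)) (h6 : M d' d ≤ -(1/2)) : False := by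
  have h := q.tree ![c, a, a', b, b', d, d'] (List.nodup_ofFn.1 (by simpa using hn))
    ![0, 0, 1, 0, 3, 0, 5] ![0, 1/2, 1/2, 1/2, 1/2, 1/2, 1/2] ![3, 2, 1, 2, 1, 2, 1] (by decide)
    (by simp [Fin.forall_fin_succ] at *; tauto)
    (by simp [Fin.forall_fin_succ]) (by norm_num) (by norm_num)
  simp [Fin.sum_univ_succ] at h
  norm_num at h

/-- Affine `E₇`. -/
theorem QL.E7 (q : QL M s) {c d a1 a2 a3 b1 b2 b3 : Fin N}
    (hn : [c, d, a1, a2, a3, b1, b2, b3].Nodup)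
    (h1 : M d c ≤ -(1/2)) (h2 : M a1 c ≤ -(1/2)) (h3 : M a2 a1 ≤ -(1/2))
    (h4 : M a3 a2 ≤ -(1/2)) (h5 : M b1 c ≤ -(1/2)) (h6 : M b2 b1 ≤ -(1/2))
    (h7 : M b3 b2 ≤ -(1/2)) : False := by
  have h := q.tree ![c, d, a1, a2, a3, b1, b2, b3] (List.nodup_ofFn.1 (by simpa using hn))
    ![0, 0, 0, 2, 3, 0, 5, 6] ![0, 1/2, 1/2, 1/2, 1/2, 1/2, 1/2, 1/2]
    ![4, 2, 3, 2, 1, 3, 2, 1] (by decide)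
    (by simp [Fin.forall_fin_succ] at *; tauto)
    (by simp [Fin.forall_fin_succ]) (by norm_num) (by norm_num)
  simp [Fin.sum_univ_succ] at h
  norm_num at h

/-- Affine `E₈`. -/
theorem QL.E8 (q : QL M s) {c d a1 a2 b1 b2 b3 b4 b5 : Fin N}
    (hn : [c, d, a1, a2, b1, b2, b3, b4, b5].Nodup)
    (h1 : M d c ≤ -(1/2)) (h2 : M a1 c ≤ -(1/2)) (h3 : M a2 a1 ≤ -(1/2))
    (h5 : M b1 c ≤ -(1/2)) (h6 : M b2 b1 ≤ -(1/2))
    (h7 : M b3 b2 ≤ -(1/2)) (h8 : M b4 b3 ≤ -(1/2)) (h9 : M b5 b4 ≤ -(1/2)) : False := by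
  have h := q.tree ![c, d, a1, a2, b1, b2, b3, b4, b5] (List.nodup_ofFn.1 (by simpa using hn))
    ![0, 0, 0, 2, 0, 4, 5, 6, 7] ![0, 1/2, 1/2, 1/2, 1/2, 1/2, 1/2, 1/2, 1/2]
    ![6, 3, 4, 2, 5, 4, 3, 2, 1] (by decide)
    (by simp [Fin.forall_fin_succ] at *; tauto)
    (by simp [Fin.forall_fin_succ]) (by norm_num) (by norm_num)
  simp [Fin.sum_univ_succ] at h
  norm_num at h

/-- Affine `B₃`. -/
theorem QL.B3 (q : QL M s) {c a b d : Fin N} (hn : [c, a, b, d].Nodup)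
    (h1 : M a c ≤ -(1/2)) (h2 : M b c ≤ -(1/2)) (h3 : M d c ≤ -s) : False := by
  have hs := q.s0
  have h := q.tree ![c, a, b, d] (List.nodup_ofFn.1 (by simpa using hn))
    ![0, 0, 0, 0] ![0, 1/2, 1/2, s] ![2, 1, 1, 2 * s] (by decide)
    (by simp [Fin.forall_fin_succ] at *; tauto)
    (by simp [Fin.forall_fin_succ, hs]) (by norm_num) (by norm_num)
  simp [Fin.sum_univ_succ] at h
  nlinarith [q.ss]

/-- Affine `B₄`. -/
theorem QL.B4 (q : QL M s) {a b v i j : Fin N} (hn : [a, b, v, i, j].Nodup)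
    (h1 : M b a ≤ -(1/2)) (h2 : M v a ≤ -(1/2)) (h4 : M i a ≤ -(1/2))
    (h3 : M j i ≤ -s) : False := by
  have hs := q.s0
  have h := q.tree ![a, b, v, i, j] (List.nodup_ofFn.1 (by simpa using hn))
    ![0, 0, 0, 0, 3] ![0, 1/2, 1/2, 1/2, s] ![2, 1, 1, 2, 2 * s] (by decide)
    (by simp [Fin.forall_fin_succ] at *; tauto)
    (by simp [Fin.forall_fin_succ, hs]) (by norm_num) (by norm_num)
  simp [Fin.sum_univ_succ] at h
  nlinarith [q.ss]

/-- Affine `F₄`. -/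
theorem QL.F4 (q : QL M s) {a b c d e : Fin N} (hn : [a, b, c, d, e].Nodup)
    (h1 : M b a ≤ -(1/2)) (h2 : M c b ≤ -(1/2)) (h3 : M d c ≤ -s)
    (h4 : M e d ≤ -(1/2)) : False := by
  have hs := q.s0
  have h := q.tree ![a, b, c, d, e] (List.nodup_ofFn.1 (by simpa using hn))
    ![0, 0, 1, 2, 3] ![0, 1/2, 1/2, s, 1/2] ![1, 2, 3, 4 * s, 2 * s] (by decide)
    (by simp [Fin.forall_fin_succ] at *; tauto)
    (by simp [Fin.forall_fin_succ, hs]) (by norm_num) (by norm_num)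
  simp [Fin.sum_univ_succ] at h
  nlinarith [q.ss]

/-- The hyperbolic extension of `H₄`. -/
theorem QL.H4 (q : QL M s) {a b c d e : Fin N} (hn : [a, b, c, d, e].Nodup)
    (h1 : M b a ≤ -(1/2)) (h2 : M c b ≤ -(1/2)) (h3 : M d c ≤ -(1/2))
    (h4 : M e d ≤ -(4/5)) : False := by
  have h := q.tree ![a, b, c, d, e] (List.nodup_ofFn.1 (by simpa using hn))
    ![0, 0, 1, 2, 3] ![0, 1/2, 1/2, 1/2, 4/5] ![1, 2, 3, 4, 16/5] (by decide)
    (by simp [Fin.forall_fin_succ] at *; tauto)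
    (by simp [Fin.forall_fin_succ]) (by norm_num) (by norm_num)
  simp [Fin.sum_univ_succ] at h
  norm_num at h


theorem QL.E8grow (q : QL M s) {c d a1 a2 b1 b2 b3 b4 : Fin N}
    (hn : [c, d, a1, a2, b1, b2, b3, b4].Nodup)
    (h1 : M d c ≤ -(1/2)) (h2 : M a1 c ≤ -(1/2)) (h3 : M a2 a1 ≤ -(1/2))
    (h5 : M b1 c ≤ -(1/2)) (h6 : M b2 b1 ≤ -(1/2))
    (h7 : M b3 b2 ≤ -(1/2)) (h8 : M b4 b3 ≤ -(1/2)) : False := by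
  obtain ⟨v, hv, t, ht, hvt⟩ := q.grow _ (List.cons_ne_nil _ _) (by simp :
    [c, d, a1, a2, b1, b2, b3, b4].length ≤ 9)
  have hn' : (v :: [c, d, a1, a2, b1, b2, b3, b4]).Nodup := List.nodup_cons.2 ⟨hv, hn⟩
  clear hn hv
  simp only [List.mem_cons, List.not_mem_nil, or_false] at ht
  rcases ht with rfl | rfl | rfl | rfl | rfl | rfl | rfl | rfl
  · exact q.D4 (by simp only [List.nodup_cons, List.mem_cons, List.not_mem_nil, not_or, or_false] at *; grind : [t, d, a1, b1, v].Nodup) h1 h2 h5 hvt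
  · exact q.E6 (by simp only [List.nodup_cons, List.mem_cons, List.not_mem_nil, not_or, or_false] at *; grind : [c, t, v, a1, a2, b1, b2].Nodup) h1 hvt h2 h3 h5 h6
  · exact q.D5 (by simp only [List.nodup_cons, List.mem_cons, List.not_mem_nil, not_or, or_false] at *; grind : [c, d, b1, t, a2, v].Nodup) h1 h5 h2 h3 hvt
  · exact q.E7 (by simp only [List.nodup_cons, List.mem_cons, List.not_mem_nil, not_or, or_false] at *; grind : [c, d, a1, t, v, b1, b2, b3].Nodup) h1 h2 h3 hvt h5 h6 h7
  · exact q.D5 (by simp only [List.nodup_cons, List.mem_cons, List.not_mem_nil, not_or, or_false] at *; grind : [c, d, a1, t, b2, v].Nodup) h1 h2 h5 h6 hvt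
  · exact q.D6 (by simp only [List.nodup_cons, List.mem_cons, List.not_mem_nil, not_or, or_false] at *; grind : [c, d, a1, b1, t, b3, v].Nodup) h1 h2 h5 h6 h7 hvt
  · exact q.D7 (by simp only [List.nodup_cons, List.mem_cons, List.not_mem_nil, not_or, or_false] at *; grind : [c, d, a1, b1, b2, t, b4, v].Nodup) h1 h2 h5 h6 h7 h8 hvt
  · exact q.E8 (by simp only [List.nodup_cons, List.mem_cons, List.not_mem_nil, not_or, or_false] at *; grind : [c, d, a1, a2, b1, b2, b3, t, v].Nodup) h1 h2 h3 h5 h6 h7 h8 hvt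

theorem QL.E7grow (q : QL M s) {c d a1 a2 b1 b2 b3 : Fin N}
    (hn : [c, d, a1, a2, b1, b2, b3].Nodup)
    (h1 : M d c ≤ -(1/2)) (h2 : M a1 c ≤ -(1/2)) (h3 : M a2 a1 ≤ -(1/2))
    (h5 : M b1 c ≤ -(1/2)) (h6 : M b2 b1 ≤ -(1/2))
    (h7 : M b3 b2 ≤ -(1/2)) : False := by
  obtain ⟨v, hv, t, ht, hvt⟩ := q.grow _ (List.cons_ne_nil _ _) (by simp :
    [c, d, a1, a2, b1, b2, b3].length ≤ 9)
  have hn' : (v :: [c, d, a1, a2, b1, b2, b3]).Nodup := List.nodup_cons.2 ⟨hv, hn⟩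
  clear hn hv
  simp only [List.mem_cons, List.not_mem_nil, or_false] at ht
  rcases ht with rfl | rfl | rfl | rfl | rfl | rfl | rfl
  · exact q.D4 (by simp only [List.nodup_cons, List.mem_cons, List.not_mem_nil, not_or, or_false] at *; grind : [t, d, a1, b1, v].Nodup) h1 h2 h5 hvt
  · exact q.E6 (by simp only [List.nodup_cons, List.mem_cons, List.not_mem_nil, not_or, or_false] at *; grind : [c, t, v, a1, a2, b1, b2].Nodup) h1 hvt h2 h3 h5 h6
  · exact q.D5 (by simp only [List.nodup_cons, List.mem_cons, List.not_mem_nil, not_or, or_false] at *; grind : [c, d, b1, t, a2, v].Nodup) h1 h5 h2 h3 hvt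
  · exact q.E7 (by simp only [List.nodup_cons, List.mem_cons, List.not_mem_nil, not_or, or_false] at *; grind : [c, d, a1, t, v, b1, b2, b3].Nodup) h1 h2 h3 hvt h5 h6 h7
  · exact q.D5 (by simp only [List.nodup_cons, List.mem_cons, List.not_mem_nil, not_or, or_false] at *; grind : [c, d, a1, t, b2, v].Nodup) h1 h2 h5 h6 hvt
  · exact q.D6 (by simp only [List.nodup_cons, List.mem_cons, List.not_mem_nil, not_or, or_false] at *; grind : [c, d, a1, b1, t, b3, v].Nodup) h1 h2 h5 h6 h7 hvt
  · exact q.E8grow (by simp only [List.nodup_cons, List.mem_cons, List.not_mem_nil, not_or, or_false] at *; grind : [c, d, a1, a2, b1, b2, t, v].Nodup) h1 h2 h3 h5 h6 h7 hvt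

theorem QL.E6grow (q : QL M s) {c d a1 a2 b1 b2 : Fin N}
    (hn : [c, d, a1, a2, b1, b2].Nodup)
    (h1 : M d c ≤ -(1/2)) (h2 : M a1 c ≤ -(1/2)) (h3 : M a2 a1 ≤ -(1/2))
    (h5 : M b1 c ≤ -(1/2)) (h6 : M b2 b1 ≤ -(1/2)) : False := by
  obtain ⟨v, hv, t, ht, hvt⟩ := q.grow _ (List.cons_ne_nil _ _) (by simp :
    [c, d, a1, a2, b1, b2].length ≤ 9)
  have hn' : (v :: [c, d, a1, a2, b1, b2]).Nodup := List.nodup_cons.2 ⟨hv, hn⟩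
  clear hn hv
  simp only [List.mem_cons, List.not_mem_nil, or_false] at ht
  rcases ht with rfl | rfl | rfl | rfl | rfl | rfl
  · exact q.D4 (by simp only [List.nodup_cons, List.mem_cons, List.not_mem_nil, not_or, or_false] at *; grind : [t, d, a1, b1, v].Nodup) h1 h2 h5 hvt
  · exact q.E6 (by simp only [List.nodup_cons, List.mem_cons, List.not_mem_nil, not_or, or_false] at *; grind : [c, t, v, a1, a2, b1, b2].Nodup) h1 hvt h2 h3 h5 h6
  · exact q.D5 (by simp only [List.nodup_cons, List.mem_cons, List.not_mem_nil, not_or, or_false] at *; grind : [c, d, b1, t, a2, v].Nodup) h1 h5 h2 h3 hvt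
  · exact q.E7grow (by simp only [List.nodup_cons, List.mem_cons, List.not_mem_nil, not_or, or_false] at *; grind : [c, d, b1, b2, a1, t, v].Nodup) h1 h5 h6 h2 h3 hvt
  · exact q.D5 (by simp only [List.nodup_cons, List.mem_cons, List.not_mem_nil, not_or, or_false] at *; grind : [c, d, a1, t, b2, v].Nodup) h1 h2 h5 h6 hvt
  · exact q.E7grow (by simp only [List.nodup_cons, List.mem_cons, List.not_mem_nil, not_or, or_false] at *; grind : [c, d, a1, a2, b1, t, v].Nodup) h1 h2 h3 h5 h6 hvt

/-- A trivalent node has at least two leaves among its neighbours. -/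
theorem QL.branch (q : QL M s) {c d a b a' b' : Fin N}
    (hn : [c, d, a, b].Nodup) (ha : a' ≠ a) (hb : b' ≠ b) (hac : a' ≠ c) (hbc : b' ≠ c)
    (h1 : M d c ≤ -(1/2)) (h2 : M a c ≤ -(1/2)) (h3 : M b c ≤ -(1/2))
    (h4 : M a' a ≤ -(1/2)) (h5 : M b' b ≤ -(1/2)) : False := by
  have y1 := q.symm a' a
  have y2 := q.symm b' b
  by_cases e1 : a' = d
  · subst e1; exact q.tri (by simp only [List.nodup_cons, List.mem_cons, List.not_mem_nil, not_or, or_false] at *; grind : [a', a, c].Nodup) h4 h2 h1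
  by_cases e2 : b' = d
  · subst e2; exact q.tri (by simp only [List.nodup_cons, List.mem_cons, List.not_mem_nil, not_or, or_false] at *; grind : [b', b, c].Nodup) h5 h3 h1
  by_cases e3 : a' = b
  · subst e3; exact q.tri (by simp only [List.nodup_cons, List.mem_cons, List.not_mem_nil, not_or, or_false] at *; grind : [a', a, c].Nodup) h4 h2 h3
  by_cases e4 : b' = a
  · subst e4; exact q.tri (by simp only [List.nodup_cons, List.mem_cons, List.not_mem_nil, not_or, or_false] at *; grind : [b', b, c].Nodup) h5 h3 h2
  by_cases e5 : a' = b'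
  · subst e5
    have y3 := q.symm a c
    exact q.sqr (by simp only [List.nodup_cons, List.mem_cons, List.not_mem_nil, not_or, or_false] at *; grind : [c, a, a', b].Nodup) (by linarith) (by linarith) h5 h3
  exact q.E6grow (by simp only [List.nodup_cons, List.mem_cons, List.not_mem_nil, not_or, or_false] at *; grind : [c, d, a, a', b, b'].Nodup) h1 h2 h4 h3 h5

theorem QL.F4grow (q : QL M s) {a i j b : Fin N} (hai : a ≠ i) (haj : a ≠ j) (hij : i ≠ j)
    (hbi : b ≠ i) (hbj : b ≠ j)
    (h1 : M a i ≤ -(1/2)) (h2 : M i j ≤ -s) (h3 : M b j ≤ -(1/2)) : False := by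
  have hsh := q.sh
  have y1 := q.symm a i
  have y2 := q.symm i j
  have y3 := q.symm b j
  by_cases e : a = b
  · subst e; exact q.tri (by simp only [List.nodup_cons, List.mem_cons, List.not_mem_nil, not_or, or_false] at *; grind : [a, i, j].Nodup) h1 (by linarith) h3
  have hn : [a, i, j, b].Nodup := by grind
  obtain ⟨v, hv, t, ht, hvt⟩ := q.grow _ (List.cons_ne_nil _ _) (by simp :
    [a, i, j, b].length ≤ 9)
  have hn' : (v :: [a, i, j, b]).Nodup := List.nodup_cons.2 ⟨hv, hn⟩
  have y4 := q.symm v t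
  clear hn hv
  simp only [List.mem_cons, List.not_mem_nil, or_false] at ht
  rcases ht with rfl | rfl | rfl | rfl
  · exact q.F4 (by simp only [List.nodup_cons, List.mem_cons, List.not_mem_nil, not_or, or_false] at *; grind : [v, t, i, j, b].Nodup) (by linarith) (by linarith) (by linarith) h3
  · exact q.B3 (by simp only [List.nodup_cons, List.mem_cons, List.not_mem_nil, not_or, or_false] at *; grind : [t, a, v, j].Nodup) h1 hvt (by linarith)
  · exact q.B3 (by simp only [List.nodup_cons, List.mem_cons, List.not_mem_nil, not_or, or_false] at *; grind : [t, b, v, i].Nodup) h3 hvt h2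
  · exact q.F4 (by simp only [List.nodup_cons, List.mem_cons, List.not_mem_nil, not_or, or_false] at *; grind : [v, t, j, i, a].Nodup) (by linarith) (by linarith) (by linarith) h1

/-- With at least eleven nodes no edge is heavier than a double edge. -/
theorem QL.H2grow (q : QL M s) {i j a : Fin N} (hai : a ≠ i) (haj : a ≠ j) (hij : i ≠ j)
    (h1 : M a i ≤ -(1/2)) (h2 : M j i ≤ -(4/5)) : False := by
  have hsh := q.sh
  have hs8 := q.s8
  have y1 := q.symm a i
  have y2 := q.symm j i
  have hn : [a, i, j].Nodup := by grind
  obtain ⟨b, hb, t, ht, hbt⟩ := q.grow _ (List.cons_ne_nil _ _) (by simp :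
    [a, i, j].length ≤ 9)
  have hn2 : (b :: [a, i, j]).Nodup := List.nodup_cons.2 ⟨hb, hn⟩
  clear hn hb
  simp only [List.mem_cons, List.not_mem_nil, or_false] at ht
  rcases ht with rfl | rfl | rfl
  · obtain ⟨v, hv, t', ht', hvt⟩ := q.grow _ (List.cons_ne_nil _ _) (by simp :
      [b, t, i, j].length ≤ 9)
    have hn' : (v :: [b, t, i, j]).Nodup := List.nodup_cons.2 ⟨hv, hn2⟩
    have y4 := q.symm v t'
    have y5 := q.symm b t
    clear hn2 hv
    simp only [List.mem_cons, List.not_mem_nil, or_false] at ht'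
    rcases ht' with rfl | rfl | rfl | rfl
    · exact q.H4 (by simp only [List.nodup_cons, List.mem_cons, List.not_mem_nil, not_or, or_false] at *; grind : [v, t', t, i, j].Nodup) (by linarith) (by linarith) (by linarith) h2
    · exact q.B4 (by simp only [List.nodup_cons, List.mem_cons, List.not_mem_nil, not_or, or_false] at *; grind : [t', b, v, i, j].Nodup) hbt hvt (by linarith) (by linarith)
    · exact q.B3 (by simp only [List.nodup_cons, List.mem_cons, List.not_mem_nil, not_or, or_false] at *; grind : [t', t, v, j].Nodup) h1 hvt (by linarith)
    · exact q.F4grow (a := t) (i := i) (j := t') (b := v) (by grind) (by grind) (by grind)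
        (by grind) (by grind) h1 (by linarith) hvt
  · exact q.B3 (by simp only [List.nodup_cons, List.mem_cons, List.not_mem_nil, not_or, or_false] at *; grind : [t, a, b, j].Nodup) h1 hbt (by linarith)
  · exact q.F4grow (a := a) (i := i) (j := t) (b := b) (by grind) (by grind) (by grind)
        (by grind) (by grind) h1 (by linarith) hbt

theorem QL.le_s (q : QL M s) {i j : Fin N} (hij : i ≠ j) : -s ≤ M i j := by
  by_contra hlt
  push Not at hlt
  have hs := q.s0
  have hsh := q.sh
  have h8 : M i j ≤ -(4/5) := by
    rcases q.off i j hij with h | h | h | h <;> linarith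
  obtain ⟨v, hv, t, ht, hvt⟩ := q.grow _ (List.cons_ne_nil _ _) (by simp :
    [i, j].length ≤ 9)
  have y := q.symm i j
  simp only [List.mem_cons, List.not_mem_nil, or_false] at ht hv
  rcases ht with rfl | rfl
  · exact q.H2grow (i := t) (j := j) (a := v) (by grind) (by grind) hij hvt (by linarith)
  · exact q.H2grow (i := t) (j := i) (a := v) (by grind) (by grind) hij.symm hvt h8

/-- The neighbours of a node. -/
noncomputable def nb (M : Matrix (Fin N) (Fin N) ℝ) (i : Fin N) : Finset (Fin N) :=
  by classical exact univ.filter fun j => M i j < 0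

theorem mem_nb {i j : Fin N} : j ∈ nb M i ↔ M i j < 0 := by
  simp [nb]

open Classical in
/-- The null (or superharmonic) vector. -/
noncomputable def uu (M : Matrix (Fin N) (Fin N) ℝ) (s : ℝ) (i : Fin N) : ℝ :=
  if 2 ≤ (nb M i).card then 1
  else if ∃ j ∈ nb M i, M i j < -(1/2) then s
  else if ∃ j ∈ nb M i, 3 ≤ (nb M j).card then 1/2 else 1

theorem QL.uu_ge (q : QL M s) (i : Fin N) : 1/2 ≤ uu M s i := by
  have := q.sh
  unfold uu; split_ifs <;> linarith

theorem QL.uu_le (q : QL M s) (i : Fin N) : uu M s i ≤ 1 := by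
  have := q.s8
  unfold uu; split_ifs <;> linarith

theorem QL.ne (q : QL M s) {i j : Fin N} (h : M i j < 0) : i ≠ j := by
  rintro rfl; rw [q.diag] at h; linarith

/-- A non-leaf neighbour has a further neighbour. -/
theorem QL.other (q : QL M s) {i j : Fin N} (h : 2 ≤ (nb M j).card) :
    ∃ k, k ≠ i ∧ k ≠ j ∧ M k j ≤ -(1/2) := by
  obtain ⟨k, hk, hki⟩ := Finset.exists_mem_ne (by omega : 1 < (nb M j).card) i
  rw [mem_nb] at hk
  exact ⟨k, hki, (q.ne hk).symm, by rw [q.symm]; exact q.half hk⟩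

theorem QL.row (q : QL M s) (i : Fin N) : 0 ≤ ∑ j, M i j * uu M s j := by
  have hs := q.s0
  have hsh := q.sh
  have hss := q.ss
  have e : ∑ j, M i j * uu M s j = uu M s i + ∑ j ∈ nb M i, M i j * uu M s j := by
    have hi : i ∉ nb M i := by rw [mem_nb, q.diag]; norm_num
    rw [← one_mul (uu M s i), ← q.diag i, ← sum_insert (f := fun j => M i j * uu M s j) hi]
    symm
    apply sum_subset (subset_univ _)
    intro j _ hj
    simp only [mem_insert, mem_nb, not_or] at hj
    have := q.neg i j (Ne.symm hj.1)
    rw [le_antisymm this (not_lt.1 hj.2), zero_mul]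
  rw [e]
  have hi1 := q.uu_ge i
  have bound : ∀ j ∈ nb M i, 2 ≤ (nb M i).card → -(1/2) ≤ M i j * uu M s j := by
    intro j hj hc
    have h1 := q.uu_le j
    have h2 := q.uu_ge j
    rw [mem_nb] at hj
    have hij := q.ne hj
    by_cases hh : M i j < -(1/2)
    · have hl := q.le_s hij
      obtain ⟨a, haj, hai, ha⟩ := q.other (i := j) hc
      have hj2 : ¬ 2 ≤ (nb M j).card := by
        intro hj2
        obtain ⟨b, hbi, hbj, hb⟩ := q.other (i := i) hj2
        exact q.F4grow hai haj hij hbi hbj ha (q.heavy hh) hb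
      have hu : uu M s j = s := by
        unfold uu
        rw [if_neg hj2, if_pos ⟨i, by rw [mem_nb, q.symm]; exact hj, by rw [q.symm]; exact hh⟩]
      rw [hu]
      nlinarith
    · push Not at hh
      nlinarith
  rcases Nat.lt_or_ge (nb M i).card 4 with h4 | h4
  swap
  · obtain ⟨T, hT, hTc⟩ := exists_subset_card_eq h4
    rw [card_eq_succ] at hTc
    obtain ⟨a, T', ha, rfl, hTc⟩ := hTc
    obtain ⟨b, d, e, hbd, hbe, hde, rfl⟩ := card_eq_three.1 hTc
    have m : ∀ x ∈ insert a ({b, d, e} : Finset (Fin N)), i ≠ x ∧ M x i ≤ -(1/2) := by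
      intro x hx
      have := hT hx
      rw [mem_nb] at this
      exact ⟨q.ne this, by rw [q.symm]; exact q.half this⟩
    have ma := m a (by simp)
    have mb := m b (by simp)
    have md := m d (by simp)
    have me := m e (by simp)
    exact (q.D4 (by simp only [List.nodup_cons, List.mem_cons, List.not_mem_nil, not_or, or_false] at *; grind : [i, a, b, d, e].Nodup) ma.2 mb.2 md.2 me.2).elim
  interval_cases hcard : (nb M i).card
  · rw [card_eq_zero.1 hcard]; simp; linarith
  · obtain ⟨j, hj⟩ := card_eq_one.1 hcard
    rw [hj, sum_singleton]
    have hjm : j ∈ nb M i := by rw [hj]; simp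
    have h1 := q.uu_le j
    have h2 := q.uu_ge j
    have hjm' := hjm
    rw [mem_nb] at hjm'
    by_cases hh : M i j < -(1/2)
    · have hu : uu M s i = s := by
        unfold uu
        rw [if_neg (by omega), if_pos ⟨j, hjm, hh⟩]
      have := q.le_s (q.ne hjm')
      rw [hu]; nlinarith
    · push Not at hh
      nlinarith
  · have hu : uu M s i = 1 := by
      unfold uu; rw [if_pos (by omega)]
    obtain ⟨j, k, hjk, hnb⟩ := card_eq_two.1 hcard
    have b1 := bound j (by rw [hnb]; simp) (by omega)
    have b2 := bound k (by rw [hnb]; simp) (by omega)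
    rw [hnb, sum_pair hjk, hu]
    linarith
  · have hu : uu M s i = 1 := by
      unfold uu; rw [if_pos (by omega)]
    obtain ⟨j, k, l, hjk, hjl, hkl, hnb⟩ := card_eq_three.1 hcard
    have m : ∀ x ∈ ({j, k, l} : Finset (Fin N)), i ≠ x ∧ M x i ≤ -(1/2) := by
      intro x hx
      rw [← hnb, mem_nb] at hx
      exact ⟨q.ne hx, by rw [q.symm]; exact q.half hx⟩
    have mj := m j (by simp)
    have mk := m k (by simp)
    have ml := m l (by simp)
    have b1 := bound j (by rw [hnb]; simp) (by omega)
    have b2 := bound k (by rw [hnb]; simp) (by omega)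
    have b3 := bound l (by rw [hnb]; simp) (by omega)
    have lj : ¬ M i j < -(1/2) := fun h =>
      q.B3 (by simp only [List.nodup_cons, List.mem_cons, List.not_mem_nil, not_or, or_false] at *; grind : [i, k, l, j].Nodup) mk.2 ml.2 (by rw [q.symm]; exact q.heavy h)
    have lk : ¬ M i k < -(1/2) := fun h =>
      q.B3 (by simp only [List.nodup_cons, List.mem_cons, List.not_mem_nil, not_or, or_false] at *; grind : [i, j, l, k].Nodup) mj.2 ml.2 (by rw [q.symm]; exact q.heavy h)
    have ll : ¬ M i l < -(1/2) := fun h =>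
      q.B3 (by simp only [List.nodup_cons, List.mem_cons, List.not_mem_nil, not_or, or_false] at *; grind : [i, j, k, l].Nodup) mj.2 mk.2 (by rw [q.symm]; exact q.heavy h)
    have leaf : ∀ x ∈ nb M i, ¬ M i x < -(1/2) → ¬ 2 ≤ (nb M x).card →
        -(1/4) ≤ M i x * uu M s x := by
      intro x hx hh hc
      have hix : i ∈ nb M x := by rw [mem_nb] at hx ⊢; rw [q.symm]; exact hx
      have hone : ∀ y ∈ nb M x, y = i := by
        intro y hy
        exact card_le_one.1 (by omega) y hy i hix
      have hux : uu M s x = 1/2 := by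
        unfold uu
        rw [if_neg hc, if_neg, if_pos ⟨i, hix, by omega⟩]
        rintro ⟨y, hy, hlt⟩
        rw [hone y hy, q.symm] at hlt
        exact hh hlt
      rw [hux]; linarith
    have key : ∀ x y z : Fin N, [i, z, x, y].Nodup → M z i ≤ -(1/2) → M x i ≤ -(1/2) →
        M y i ≤ -(1/2) → ¬ (2 ≤ (nb M x).card ∧ 2 ≤ (nb M y).card) := by
      rintro x y z hn hz hx hy ⟨cx, cy⟩
      obtain ⟨x', a1, a2, a3⟩ := q.other (i := i) cx
      obtain ⟨y', c1, c2, c3⟩ := q.other (i := i) cy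
      exact q.branch hn a2 c2 a1 c1 hz hx hy a3 c3
    have k1 := key j k l (by grind) ml.2 mj.2 mk.2
    have k2 := key j l k (by grind) mk.2 mj.2 ml.2
    have k3 := key k l j (by grind) mj.2 mk.2 ml.2
    have f1 := leaf j (by rw [hnb]; simp) lj
    have f2 := leaf k (by rw [hnb]; simp) lk
    have f3 := leaf l (by rw [hnb]; simp) ll
    rw [hnb, sum_insert (by simp [hjk, hjl]), sum_pair hkl, hu]
    by_cases p1 : 2 ≤ (nb M j).card
    · have g2 := f2 (fun h => k1 ⟨p1, h⟩)
      have g3 := f3 (fun h => k2 ⟨p1, h⟩)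
      linarith
    · have g1 := f1 p1
      by_cases p2 : 2 ≤ (nb M k).card
      · have g3 := f3 (fun h => k3 ⟨p2, h⟩)
        linarith
      · have g2 := f2 p2
        linarith

theorem QL.false (q : QL M s) : False :=
  q.npsd (psd_of_vec q.symm q.neg (uu M s) (fun i => by linarith [q.uu_ge i]) q.row)

end

theorem cos_cases (m : ℕ) (hm : 2 ≤ m) :
    -Real.cos (Real.pi / m) = 0 ∨ -Real.cos (Real.pi / m) = -(1/2) ∨
    -Real.cos (Real.pi / m) = -(√2 / 2) ∨ -Real.cos (Real.pi / m) ≤ -(4/5) := by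
  rcases Nat.lt_or_ge m 5 with h | h
  · interval_cases m
    · left; simp
    · right; left; simp
    · right; right; left; simp
  · right; right; right
    have h5 : Real.cos (Real.pi / 5) ≤ Real.cos (Real.pi / m) := by
      have hm' : (5 : ℝ) ≤ m := by exact_mod_cast h
      have hpi := Real.pi_pos
      apply Real.cos_le_cos_of_nonneg_of_le_pi
      · positivity
      · linarith
      · gcongr
    rw [Real.cos_pi_div_five] at h5
    have : (2.2 : ℝ) ≤ √5 := Real.le_sqrt_of_sq_le (by norm_num)
    linarith

theorem Q_eq {N : ℕ} (M : Matrix (Fin N) (Fin N) ℝ) (x : Fin N → ℝ) :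
    star x ⬝ᵥ (M.mulVec x) = Q M x := by
  simp only [dotProduct, Matrix.mulVec, Q, mul_sum, star_trivial]
  refine sum_congr rfl fun i _ => sum_congr rfl fun j _ => by ring

end QLan

/-- A quasi-Lannér diagram has at most 10 vertices: if `M` is a
symmetric real `N × N` matrix with unit diagonal whose off-diagonal entries are
each either `−cos(π/m)` for an integer `m ≥ 2` or a real `≤ −1`, and every proper
principal submatrix of `M` is positive semidefinite while `M` is not positive
semidefinite, then `N ≤ 10`. -/
theorem quasi_lanner_diagram_card_le_ten
    (N : ℕ) (M : Matrix (Fin N) (Fin N) ℝ)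
    (hsymm : M.IsSymm)
    (hdiag : ∀ i, M i i = 1)
    (hoff : ∀ i j, i ≠ j →
      (∃ m : ℕ, 2 ≤ m ∧ M i j = -Real.cos (Real.pi / m)) ∨ M i j ≤ -1)
    (hproper : ∀ S : Finset (Fin N), S ≠ Finset.univ →
      (M.submatrix (Subtype.val : {i // i ∈ S} → Fin N) Subtype.val).PosSemidef)
    (hM : ¬ M.PosSemidef) :
    N ≤ 10 := by
  by_contra hN
  have h2 : (√2 : ℝ) * √2 = 2 := Real.mul_self_sqrt (by norm_num)
  have h2p : (1 : ℝ) ≤ √2 := Real.one_le_sqrt.2 (by norm_num)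
  have q : QLan.QL M (√2 / 2) :=
    { s0 := by linarith
      ss := by linarith
      s8 := by nlinarith
      sh := by linarith
      symm := fun i j => (hsymm.apply i j).symm
      diag := hdiag
      off := by
        intro i j hij
        rcases hoff i j hij with ⟨m, hm, h⟩ | h
        · rw [h]; exact QLan.cos_cases m hm
        · right; right; right; linarith
      sub := by
        rintro x ⟨v, hv⟩
        have h := (hproper (Finset.univ.erase v) (by
          intro h
          have := Finset.mem_univ v
          rw [← h] at this
          simp at this)).dotProduct_mulVec_nonneg (fun i => x i)
        have e : ∀ g : Fin N → ℝ, g v = 0 →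
            ∑ i : {i // i ∈ Finset.univ.erase v}, g i = ∑ i, g i := by
          intro g hg
          rw [Finset.sum_coe_sort (Finset.univ.erase v) g, Finset.sum_erase _ hg]
        simp only [dotProduct, Matrix.mulVec, Matrix.submatrix_apply, Pi.star_apply,
          star_trivial] at h
        rw [← QLan.Q_eq]
        simp only [dotProduct, Matrix.mulVec, Pi.star_apply, star_trivial]
        rw [← e (fun i => x i * ∑ j, M i j * x j) (by simp [hv])]
        refine le_of_le_of_eq h (Finset.sum_congr rfl fun i _ => ?_)
        exact congrArg (x i * ·) (e (fun j => M i j * x j) (by simp [hv]))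
      npsd := by
        intro h
        apply hM
        refine Matrix.PosSemidef.of_dotProduct_mulVec_nonneg ?_ ?_
        · ext i j
          simp [hsymm.apply i j]
        · intro x
          rw [QLan.Q_eq]; exact h x
      hN := by omega }
  exact q.false
end
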